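/- arXiv:2602.16460 — 2 statements merged into one kernel-verified Lean document; each statement's English description precedes it below -/
import Mathlib

section
/- Let A, C be real numbers with B = 0, (A,C) ≠ (0,0), A ≤ 0 and C ≥ 3|A|, and set F(y) = 3Ay² + C. Let ψ : ℝ × [-1,1] → ℝ be a smooth function for which there exists M > 0 such that for every a ∈ ℝ the integral over (a,a+1) × (-1,1) of the sum of the squares of all partial derivatives of ψ of order between 1 and 3 is at most M. Assume ψ is even in y, i.e. ψ(x,−y) = ψ(x,y) for all (x,y). If ψ satisfies the full nonlinear stream-function equation ψ_xxxx + 2ψ_xxyy + ψ_yyyy − [F(y)(ψ_xyy + ψ_xxx) − 6Aψ_x] + (ψ_x(Δψ)_y − ψ_y(Δψ)_x) = 0 in S = ℝ × (-1,1), where Δψ = ψ_xx + ψ_yy, together with ψ(x,±1) = ψ_x(x,±1) = ψ_y(x,±1) = 0 for all x ∈ ℝ, then ψ is identically zero. -/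
open MeasureTheory intervalIntegral

/-- Partial derivative in the first (horizontal) variable. -/
noncomputable def pdx (f : ℝ → ℝ → ℝ) : ℝ → ℝ → ℝ := fun x y => deriv (fun t => f t y) x

/-- Partial derivative in the second (vertical) variable. -/
noncomputable def pdy (f : ℝ → ℝ → ℝ) : ℝ → ℝ → ℝ := fun x y => deriv (fun t => f x t) y

/-- Joint smoothness of a function of two real variables. -/
def JointlySmooth (f : ℝ → ℝ → ℝ) : Prop := ContDiff ℝ (⊤ : ℕ∞) (Function.uncurry f)

namespace JointlySmooth

variable {f g : ℝ → ℝ → ℝ}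

theorem differentiable (hf : JointlySmooth f) : Differentiable ℝ (Function.uncurry f) :=
  ContDiff.differentiable hf (by simp)

theorem pdx_eq_fderiv (hf : JointlySmooth f) (x y : ℝ) :
    pdx f x y = fderiv ℝ (Function.uncurry f) (x, y) (1, 0) := by
  have h1 : HasDerivAt (fun t : ℝ => (t, y)) ((1 : ℝ), (0 : ℝ)) x :=
    (hasDerivAt_id x).prodMk (hasDerivAt_const x y)
  exact ((hf.differentiable (x, y)).hasFDerivAt.comp_hasDerivAt x h1).deriv

theorem pdy_eq_fderiv (hf : JointlySmooth f) (x y : ℝ) :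
    pdy f x y = fderiv ℝ (Function.uncurry f) (x, y) (0, 1) := by
  have h1 : HasDerivAt (fun t : ℝ => (x, t)) ((0 : ℝ), (1 : ℝ)) y :=
    (hasDerivAt_const y x).prodMk (hasDerivAt_id y)
  exact ((hf.differentiable (x, y)).hasFDerivAt.comp_hasDerivAt y h1).deriv

theorem fderiv_apply (hf : JointlySmooth f) (v : ℝ × ℝ) :
    ContDiff ℝ (⊤ : ℕ∞) (fun p => fderiv ℝ (Function.uncurry f) p v) :=
  (ContDiff.fderiv_right (m := (⊤ : ℕ∞)) hf (by simp)).clm_apply contDiff_const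

theorem pdx (hf : JointlySmooth f) : JointlySmooth (pdx f) := by
  have h : Function.uncurry (_root_.pdx f)
      = fun p => fderiv ℝ (Function.uncurry f) p (1, 0) := by
    funext ⟨x, y⟩
    exact hf.pdx_eq_fderiv x y
  unfold JointlySmooth
  rw [h]
  exact hf.fderiv_apply _

theorem pdy (hf : JointlySmooth f) : JointlySmooth (pdy f) := by
  have h : Function.uncurry (_root_.pdy f)
      = fun p => fderiv ℝ (Function.uncurry f) p (0, 1) := by
    funext ⟨x, y⟩
    exact hf.pdy_eq_fderiv x y
  unfold JointlySmooth
  rw [h]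
  exact hf.fderiv_apply _

theorem hasDerivAt_left (hf : JointlySmooth f) (x y : ℝ) :
    HasDerivAt (fun t => f t y) (_root_.pdx f x y) x := by
  have h1 : HasDerivAt (fun t : ℝ => (t, y)) ((1 : ℝ), (0 : ℝ)) x :=
    (hasDerivAt_id x).prodMk (hasDerivAt_const x y)
  exact ((hf.differentiable (x, y)).hasFDerivAt.comp_hasDerivAt x h1).differentiableAt.hasDerivAt

theorem hasDerivAt_right (hf : JointlySmooth f) (x y : ℝ) :
    HasDerivAt (fun t => f x t) (_root_.pdy f x y) y := by
  have h1 : HasDerivAt (fun t : ℝ => (x, t)) ((0 : ℝ), (1 : ℝ)) y :=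
    (hasDerivAt_const y x).prodMk (hasDerivAt_id y)
  exact ((hf.differentiable (x, y)).hasFDerivAt.comp_hasDerivAt y h1).differentiableAt.hasDerivAt

theorem continuous_left (hf : JointlySmooth f) (y : ℝ) : Continuous (fun t => f t y) :=
  continuous_iff_continuousAt.2 fun x => (hf.hasDerivAt_left x y).continuousAt

theorem continuous_right (hf : JointlySmooth f) (x : ℝ) : Continuous (fun t => f x t) :=
  continuous_iff_continuousAt.2 fun y => (hf.hasDerivAt_right x y).continuousAt

theorem pdx_pdy_comm (hf : JointlySmooth f) :
    _root_.pdx (_root_.pdy f) = _root_.pdy (_root_.pdx f) := by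
  funext x y
  have hd : DifferentiableAt ℝ (fderiv ℝ (Function.uncurry f)) (x, y) :=
    (ContDiff.fderiv_right (m := (⊤ : ℕ∞)) hf (by simp)).differentiable (by simp) (x, y)
  have key : ∀ u v : ℝ × ℝ, fderiv ℝ (fun p => fderiv ℝ (Function.uncurry f) p u) (x, y) v
      = fderiv ℝ (fderiv ℝ (Function.uncurry f)) (x, y) v u := by
    intro u v
    rw [fderiv_clm_apply hd (differentiableAt_const u)]
    simp
  have hX : Function.uncurry (_root_.pdx f)
      = fun p => fderiv ℝ (Function.uncurry f) p (1, 0) := by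
    funext ⟨x, y⟩
    exact hf.pdx_eq_fderiv x y
  have hY : Function.uncurry (_root_.pdy f)
      = fun p => fderiv ℝ (Function.uncurry f) p (0, 1) := by
    funext ⟨x, y⟩
    exact hf.pdy_eq_fderiv x y
  rw [hf.pdy.pdx_eq_fderiv, hf.pdx.pdy_eq_fderiv, hX, hY, key, key]
  have hs : IsSymmSndFDerivAt ℝ (Function.uncurry f) (x, y) :=
    (ContDiff.contDiffAt hf).isSymmSndFDerivAt (by
      simpa using WithTop.coe_le_coe.2 (le_top : (2 : ℕ∞) ≤ ⊤))
  exact hs.eq _ _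

theorem add (hf : JointlySmooth f) (hg : JointlySmooth g) :
    JointlySmooth (fun x y => f x y + g x y) := ContDiff.add hf hg

theorem sub (hf : JointlySmooth f) (hg : JointlySmooth g) :
    JointlySmooth (fun x y => f x y - g x y) := ContDiff.sub hf hg

theorem mul (hf : JointlySmooth f) (hg : JointlySmooth g) :
    JointlySmooth (fun x y => f x y * g x y) := ContDiff.mul hf hg

theorem pdx_add (hf : JointlySmooth f) (hg : JointlySmooth g) :
    _root_.pdx (fun x y => f x y + g x y)
      = fun x y => _root_.pdx f x y + _root_.pdx g x y := by
  funext x y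
  exact ((hf.hasDerivAt_left x y).add (hg.hasDerivAt_left x y)).deriv

theorem pdy_add (hf : JointlySmooth f) (hg : JointlySmooth g) :
    _root_.pdy (fun x y => f x y + g x y)
      = fun x y => _root_.pdy f x y + _root_.pdy g x y := by
  funext x y
  exact ((hf.hasDerivAt_right x y).add (hg.hasDerivAt_right x y)).deriv

theorem pdy_sub (hf : JointlySmooth f) (hg : JointlySmooth g) :
    _root_.pdy (fun x y => f x y - g x y)
      = fun x y => _root_.pdy f x y - _root_.pdy g x y := by
  funext x y
  exact ((hf.hasDerivAt_right x y).sub (hg.hasDerivAt_right x y)).deriv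

theorem pdy_mul (hf : JointlySmooth f) (hg : JointlySmooth g) :
    _root_.pdy (fun x y => f x y * g x y)
      = fun x y => _root_.pdy f x y * g x y + f x y * _root_.pdy g x y := by
  funext x y
  exact ((hf.hasDerivAt_right x y).mul (hg.hasDerivAt_right x y)).deriv

/-- A smooth function vanishing in the open strip vanishes on its lower boundary. -/
theorem eq_zero_at_bottom (hf : JointlySmooth f)
    (h : ∀ x : ℝ, ∀ y ∈ Set.Ioo (-1 : ℝ) 1, f x y = 0) (x : ℝ) : f x (-1) = 0 := by
  have hcl : (-1 : ℝ) ∈ closure (Set.Ioo (-1 : ℝ) 1) := by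
    rw [closure_Ioo (by norm_num)]
    norm_num
  have hset : IsClosed {y : ℝ | f x y = 0} :=
    isClosed_eq (hf.continuous_right x) continuous_const
  exact hset.closure_subset_iff.2 (fun y hy => h x y hy) hcl

end JointlySmooth

theorem pdy_eq_zero_of_strip {f : ℝ → ℝ → ℝ}
    (h : ∀ x : ℝ, ∀ y ∈ Set.Ioo (-1 : ℝ) 1, f x y = 0) :
    ∀ x : ℝ, ∀ y ∈ Set.Ioo (-1 : ℝ) 1, pdy f x y = 0 := by
  intro x y hy
  have : (fun t => f x t) =ᶠ[nhds y] fun _ => (0 : ℝ) := by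
    filter_upwards [isOpen_Ioo.mem_nhds hy] with t ht using h x t ht
  unfold pdy
  rw [this.deriv_eq, deriv_const]

theorem pdx_eq_zero_of_horizontal {f : ℝ → ℝ → ℝ} {y : ℝ} (h : ∀ x, f x y = 0) (x : ℝ) :
    pdx f x y = 0 := by
  unfold pdx
  simp [h]

/-- The `x`-derivative preserves parity in `y`. -/
theorem pdx_parity {f : ℝ → ℝ → ℝ} {ε : ℝ} (h : ∀ x y, f x (-y) = ε * f x y) (x y : ℝ) :
    pdx f x (-y) = ε * pdx f x y := by
  unfold pdx
  simp [h]

/-- The `y`-derivative reverses parity in `y`. -/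
theorem pdy_parity {f : ℝ → ℝ → ℝ} {ε : ℝ} (h : ∀ x y, f x (-y) = ε * f x y) (x y : ℝ) :
    pdy f x (-y) = -ε * pdy f x y := by
  unfold pdy
  have h1 : (fun t => f x t) = fun t => ε * f x (-t) := by
    funext t
    have := h x (-t)
    rwa [neg_neg] at this
  have h2 : deriv (fun t => f x t) (-y) = deriv (fun t => ε * f x (-t)) (-y) := by rw [← h1]
  rw [h2, deriv_const_mul_field, deriv_comp_neg, neg_neg]
  ring

/-- Separation of the equation into its even (linear) and odd (quadratic) parts. -/
theorem even_odd_split {ψ : ℝ → ℝ → ℝ} {A C : ℝ} (hsymm : ∀ x y : ℝ, ψ x (-y) = ψ x y)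
    (heq : ∀ x : ℝ, ∀ y ∈ Set.Ioo (-1 : ℝ) 1,
      pdx (pdx (pdx (pdx ψ))) x y + 2 * pdy (pdy (pdx (pdx ψ))) x y
          + pdy (pdy (pdy (pdy ψ))) x y
        - ((3 * A * y ^ 2 + C) * (pdy (pdy (pdx ψ)) x y + pdx (pdx (pdx ψ)) x y)
            - 6 * A * pdx ψ x y)
        + (pdx ψ x y * pdy (fun a b => pdx (pdx ψ) a b + pdy (pdy ψ) a b) x y
            - pdy ψ x y * pdx (fun a b => pdx (pdx ψ) a b + pdy (pdy ψ) a b) x y) = 0)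
    (x y : ℝ) (hy : y ∈ Set.Ioo (-1 : ℝ) 1) :
    pdx (pdx (pdx (pdx ψ))) x y + 2 * pdy (pdy (pdx (pdx ψ))) x y
          + pdy (pdy (pdy (pdy ψ))) x y
        - ((3 * A * y ^ 2 + C) * (pdy (pdy (pdx ψ)) x y + pdx (pdx (pdx ψ)) x y)
            - 6 * A * pdx ψ x y) = 0 ∧
      pdx ψ x y * pdy (fun a b => pdx (pdx ψ) a b + pdy (pdy ψ) a b) x y
            - pdy ψ x y * pdx (fun a b => pdx (pdx ψ) a b + pdy (pdy ψ) a b) x y = 0 := by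
  have h0 : ∀ x y, ψ x (-y) = 1 * ψ x y := by simpa using hsymm
  have hω : ∀ x y, (fun a b => pdx (pdx ψ) a b + pdy (pdy ψ) a b) x (-y)
      = 1 * (fun a b => pdx (pdx ψ) a b + pdy (pdy ψ) a b) x y := by
    intro x y
    have e1 := pdx_parity (pdx_parity h0) x y
    have e2 := pdy_parity (pdy_parity h0) x y
    simp only [e1, e2]
    ring
  have hy' : -y ∈ Set.Ioo (-1 : ℝ) 1 := ⟨by linarith [hy.2], by linarith [hy.1]⟩
  have e := heq x y hy
  have e' := heq x (-y) hy'
  rw [pdx_parity (pdx_parity (pdx_parity (pdx_parity h0))),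
    pdy_parity (pdy_parity (pdx_parity (pdx_parity h0))),
    pdy_parity (pdy_parity (pdy_parity (pdy_parity h0))),
    pdy_parity (pdy_parity (pdx_parity h0)), pdx_parity (pdx_parity (pdx_parity h0)),
    pdx_parity h0, pdy_parity h0, pdy_parity hω, pdx_parity hω] at e'
  constructor <;> linarith

section Boundary

variable {ψ : ℝ → ℝ → ℝ}

/-- If `h * h' = 0` everywhere then `h' = 0` everywhere. -/
theorem deriv_eq_zero_of_mul_deriv_eq_zero {h h' : ℝ → ℝ} (hd : ∀ x, HasDerivAt h (h' x) x)
    (hz : ∀ x, h x * h' x = 0) (x : ℝ) : h' x = 0 := by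
  have hsq : ∀ x y, h x ^ 2 = h y ^ 2 := by
    refine is_const_of_deriv_eq_zero (fun x => ((hd x).pow 2).differentiableAt) fun x => ?_
    refine ((hd x).pow 2).deriv.trans ?_
    have := hz x
    simp only [Nat.cast_ofNat, Nat.add_one_sub_one, pow_one]
    linear_combination 2 * this
  by_cases hx : h x = 0
  · have hall : h = fun _ => 0 := by
      funext t
      have := hsq t x
      rw [hx] at this
      simpa using this
    have h1 := hd x
    rw [hall] at h1
    exact h1.unique (hasDerivAt_const x 0)
  · exact (mul_eq_zero.1 (hz x)).resolve_left hx

/-- The vanishing of the quadratic term forces the wall values of `ψ_yy` and `ψ_yyy` to be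
constant along the wall. -/
theorem wall_derivatives_constant (hψ : JointlySmooth ψ)
    (hJ : ∀ x : ℝ, ∀ y ∈ Set.Ioo (-1 : ℝ) 1,
      pdx ψ x y * pdy (fun a b => pdx (pdx ψ) a b + pdy (pdy ψ) a b) x y
            - pdy ψ x y * pdx (fun a b => pdx (pdx ψ) a b + pdy (pdy ψ) a b) x y = 0)
    (h0 : ∀ x, ψ x (-1) = 0) (h1 : ∀ x, pdy ψ x (-1) = 0) :
    (∀ x, pdx (pdy (pdy ψ)) x (-1) = 0) ∧ ∀ x, pdx (pdy (pdy (pdy ψ))) x (-1) = 0 := by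
  set ω : ℝ → ℝ → ℝ := fun a b => pdx (pdx ψ) a b + pdy (pdy ψ) a b with hω
  have sω : JointlySmooth ω := hψ.pdx.pdx.add hψ.pdy.pdy
  have sa := hψ.pdx
  have sb := sω.pdy
  have sc := hψ.pdy
  have sd := sω.pdx
  have sJ := (sa.mul sb).sub (sc.mul sd)
  have J1 := sJ.pdy.eq_zero_at_bottom (pdy_eq_zero_of_strip hJ)
  have J2 := sJ.pdy.pdy.eq_zero_at_bottom (pdy_eq_zero_of_strip (pdy_eq_zero_of_strip hJ))
  have J3 := sJ.pdy.pdy.pdy.eq_zero_at_bottom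
    (pdy_eq_zero_of_strip (pdy_eq_zero_of_strip (pdy_eq_zero_of_strip hJ)))
  have E1 := JointlySmooth.pdy_sub (sa.mul sb) (sc.mul sd)
  rw [sa.pdy_mul sb, sc.pdy_mul sd] at E1
  rw [E1] at J1 J2 J3
  have E2 := JointlySmooth.pdy_sub ((sa.pdy.mul sb).add (sa.mul sb.pdy))
    ((sc.pdy.mul sd).add (sc.mul sd.pdy))
  rw [JointlySmooth.pdy_add (sa.pdy.mul sb) (sa.mul sb.pdy),
    JointlySmooth.pdy_add (sc.pdy.mul sd) (sc.mul sd.pdy),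
    sa.pdy.pdy_mul sb, sa.pdy_mul sb.pdy, sc.pdy.pdy_mul sd, sc.pdy_mul sd.pdy] at E2
  rw [E2] at J2 J3
  have E3 := JointlySmooth.pdy_sub
    (((sa.pdy.pdy.mul sb).add (sa.pdy.mul sb.pdy)).add ((sa.pdy.mul sb.pdy).add (sa.mul sb.pdy.pdy)))
    (((sc.pdy.pdy.mul sd).add (sc.pdy.mul sd.pdy)).add ((sc.pdy.mul sd.pdy).add (sc.mul sd.pdy.pdy)))
  rw [JointlySmooth.pdy_add ((sa.pdy.pdy.mul sb).add (sa.pdy.mul sb.pdy))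
      ((sa.pdy.mul sb.pdy).add (sa.mul sb.pdy.pdy)),
    JointlySmooth.pdy_add ((sc.pdy.pdy.mul sd).add (sc.pdy.mul sd.pdy))
      ((sc.pdy.mul sd.pdy).add (sc.mul sd.pdy.pdy)),
    JointlySmooth.pdy_add (sa.pdy.pdy.mul sb) (sa.pdy.mul sb.pdy),
    JointlySmooth.pdy_add (sa.pdy.mul sb.pdy) (sa.mul sb.pdy.pdy),
    JointlySmooth.pdy_add (sc.pdy.pdy.mul sd) (sc.pdy.mul sd.pdy),
    JointlySmooth.pdy_add (sc.pdy.mul sd.pdy) (sc.mul sd.pdy.pdy),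
    sa.pdy.pdy.pdy_mul sb, sa.pdy.pdy_mul sb.pdy, sa.pdy_mul sb.pdy.pdy,
    sc.pdy.pdy.pdy_mul sd, sc.pdy.pdy_mul sd.pdy, sc.pdy_mul sd.pdy.pdy] at E3
  rw [E3] at J3
  beta_reduce at J1 J2 J3
  have a0 : ∀ x, pdx ψ x (-1) = 0 := pdx_eq_zero_of_horizontal h0
  have a1 : ∀ x, pdy (pdx ψ) x (-1) = 0 := by
    rw [← hψ.pdx_pdy_comm]
    exact pdx_eq_zero_of_horizontal h1
  have a2 : ∀ x, pdy (pdy (pdx ψ)) x (-1) = pdx (pdy (pdy ψ)) x (-1) := by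
    rw [hψ.pdy.pdx_pdy_comm, hψ.pdx_pdy_comm]
    exact fun x => rfl
  have a3 : ∀ x, pdy (pdy (pdy (pdx ψ))) x (-1) = pdx (pdy (pdy (pdy ψ))) x (-1) := by
    rw [hψ.pdy.pdy.pdx_pdy_comm, hψ.pdy.pdx_pdy_comm, hψ.pdx_pdy_comm]
    exact fun x => rfl
  have b0 : ∀ x, pdy ω x (-1) = pdy (pdy (pdy ψ)) x (-1) := by
    intro x
    rw [hω, JointlySmooth.pdy_add hψ.pdx.pdx hψ.pdy.pdy]
    beta_reduce
    rw [← hψ.pdx.pdx_pdy_comm, ← hψ.pdx_pdy_comm,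
      pdx_eq_zero_of_horizontal (pdx_eq_zero_of_horizontal h1), zero_add]
  have d0 : ∀ x, pdx ω x (-1) = pdx (pdy (pdy ψ)) x (-1) := by
    intro x
    rw [hω, JointlySmooth.pdx_add hψ.pdx.pdx hψ.pdy.pdy]
    beta_reduce
    rw [pdx_eq_zero_of_horizontal (pdx_eq_zero_of_horizontal a0), zero_add]
  have d1 : ∀ x, pdy (pdx ω) x (-1) = pdx (pdy (pdy (pdy ψ))) x (-1) := by
    intro x
    rw [← sω.pdx_pdy_comm]
    unfold pdx
    simp only [b0]
  have w0 : ∀ x, pdx (pdy (pdy ψ)) x (-1) = 0 := by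
    refine deriv_eq_zero_of_mul_deriv_eq_zero (h := fun x => pdy (pdy ψ) x (-1))
      (fun x => hψ.pdy.pdy.hasDerivAt_left x (-1)) fun x => ?_
    have := J1 x
    rw [a0, a1, h1, d0] at this
    linarith
  refine ⟨w0, ?_⟩
  refine deriv_eq_zero_of_mul_deriv_eq_zero (h := fun x => pdy (pdy (pdy ψ)) x (-1))
      (fun x => hψ.pdy.pdy.pdy.hasDerivAt_left x (-1)) fun x => ?_
  have j2 := J2 x
  have j3 := J3 x
  rw [a0, a1, a2, h1, d0, d1, w0] at j2
  rw [a0, a1, a2, a3, b0, h1, d0, d1, w0] at j3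
  have j2' : pdy (pdy ψ) x (-1) * pdx (pdy (pdy (pdy ψ))) x (-1) = 0 := by linarith
  rcases mul_eq_zero.1 j2' with hw | hc
  · rw [hw] at j3
    linarith
  · rw [hc, mul_zero]

end Boundary

/-- Taylor expansion at the wall of a solution of the linear equation, with the `y`-derivatives
in the remainder integrated by parts. -/
theorem wall_taylor {ψ : ℝ → ℝ → ℝ} {A C : ℝ} (hψ : JointlySmooth ψ)
    (hlin : ∀ x : ℝ, ∀ y ∈ Set.Ioo (-1 : ℝ) 1,
      pdx (pdx (pdx (pdx ψ))) x y + 2 * pdy (pdy (pdx (pdx ψ))) x y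
          + pdy (pdy (pdy (pdy ψ))) x y
        - ((3 * A * y ^ 2 + C) * (pdy (pdy (pdx ψ)) x y + pdx (pdx (pdx ψ)) x y)
            - 6 * A * pdx ψ x y) = 0)
    (h0 : ∀ x, ψ x (-1) = 0) (h1 : ∀ x, pdy ψ x (-1) = 0) (x : ℝ) {y : ℝ}
    (hy : y ∈ Set.Icc (-1 : ℝ) 1) :
    ψ x y = pdy (pdy ψ) x (-1) * ((y + 1) ^ 2 / 2)
      + pdy (pdy (pdy ψ)) x (-1) * ((y + 1) ^ 3 / 6)
      + ((∫ t in (-1 : ℝ)..y, (-2 * (y - t)) * pdx (pdx ψ) x t)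
        + (∫ t in (-1 : ℝ)..y, ((y - t) * (3 * A * t ^ 2 + C) - (y - t) ^ 2 * (6 * A * t))
            * pdx ψ x t)
        + (∫ t in (-1 : ℝ)..y, (-(y - t) ^ 3 / 6) * pdx (pdx (pdx (pdx ψ))) x t)
        + ∫ t in (-1 : ℝ)..y, ((y - t) ^ 3 / 6 * (3 * A * t ^ 2 + C))
            * pdx (pdx (pdx ψ)) x t) := by
  have a0 : ∀ x, pdx ψ x (-1) = 0 := pdx_eq_zero_of_horizontal h0
  have a1 : ∀ x, pdy (pdx ψ) x (-1) = 0 := by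
    rw [← hψ.pdx_pdy_comm]
    exact pdx_eq_zero_of_horizontal h1
  have a2 : ∀ x, pdx (pdx ψ) x (-1) = 0 := pdx_eq_zero_of_horizontal a0
  have a3 : ∀ x, pdy (pdx (pdx ψ)) x (-1) = 0 := by
    rw [← hψ.pdx.pdx_pdy_comm]
    exact pdx_eq_zero_of_horizontal a1
  have c1 := hψ.pdx.continuous_right x
  have c2 := hψ.pdx.pdx.continuous_right x
  have c3 := hψ.pdx.pdx.pdx.continuous_right x
  have c4 := hψ.pdx.pdx.pdx.pdx.continuous_right x
  rw [← integral_add (Continuous.intervalIntegrable (by fun_prop) _ _)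
      (Continuous.intervalIntegrable (by fun_prop) _ _),
    ← integral_add (Continuous.intervalIntegrable (by fun_prop) _ _)
      (Continuous.intervalIntegrable (by fun_prop) _ _),
    ← integral_add (Continuous.intervalIntegrable (by fun_prop) _ _)
      (Continuous.intervalIntegrable (by fun_prop) _ _)]
  have hg : ∀ t, HasDerivAt (fun t : ℝ => y - t) (-1) t := fun t => by
    simpa using (hasDerivAt_id t).const_sub y
  have hF : ∀ t, HasDerivAt (fun t : ℝ => 3 * A * t ^ 2 + C) (6 * A * t) t := fun t => by
    have := (((hasDerivAt_id t).pow 2).const_mul (3 * A)).add_const C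
    refine this.congr_deriv ?_
    simp
    ring
  have hF' : ∀ t, HasDerivAt (fun t : ℝ => 6 * A * t) (6 * A) t := fun t => by
    simpa using (hasDerivAt_id t).const_mul (6 * A)
  have d0 := hψ.hasDerivAt_right x
  have d1 := hψ.pdy.hasDerivAt_right x
  have d2 := hψ.pdy.pdy.hasDerivAt_right x
  have d3 := hψ.pdy.pdy.pdy.hasDerivAt_right x
  have e0 := hψ.pdx.pdx.hasDerivAt_right x
  have e1 := hψ.pdx.pdx.pdy.hasDerivAt_right x
  have b0 := hψ.pdx.hasDerivAt_right x
  have b1 := hψ.pdx.pdy.hasDerivAt_right x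
  have hΦ := fun t : ℝ =>
    (((((d0 t).add ((hg t).mul (d1 t))).add ((((hg t).pow 2).div_const 2).mul (d2 t))).add
      ((((hg t).pow 3).div_const 6).mul (d3 t))).add
      (((((hg t).pow 3).div_const 6).mul (e1 t)).add
        ((((hg t).pow 2).div_const 2).mul (e0 t)) |>.const_mul 2)).sub
      ((((((hg t).pow 3).div_const 6).mul (hF t)).mul (b1 t)).sub
        ((((((hg t).pow 2).div_const 2).mul (hF t)).neg.add
          ((((hg t).pow 3).div_const 6).mul (hF' t))).mul (b0 t)))
  have key := integral_eq_sub_of_hasDerivAt_of_le hy.1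
    (fun t _ => (hΦ t).continuousAt.continuousWithinAt)
    (f' := fun t => -2 * (y - t) * pdx (pdx ψ) x t
      + ((y - t) * (3 * A * t ^ 2 + C) - (y - t) ^ 2 * (6 * A * t)) * pdx ψ x t
      + -(y - t) ^ 3 / 6 * pdx (pdx (pdx (pdx ψ))) x t
      + (y - t) ^ 3 / 6 * (3 * A * t ^ 2 + C) * pdx (pdx (pdx ψ)) x t)
    (fun t ht => (hΦ t).congr_deriv ?_)
    (Continuous.intervalIntegrable (by fun_prop) _ _)
  · rw [key]
    simp [h0, h1, a0, a1, a2, a3]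
    ring
  · have hl := hlin x t ⟨ht.1, ht.2.trans_le hy.2⟩
    simp
    linear_combination (y - t) ^ 3 / 6 * hl

/-- Differentiation under the integral sign for smooth integrands on a compact interval. -/
theorem JointlySmooth.hasDerivAt_integral {f : ℝ → ℝ → ℝ} (hf : JointlySmooth f) {p : ℝ → ℝ}
    (hp : Continuous p) (a b x : ℝ) :
    HasDerivAt (fun x => ∫ t in a..b, p t * f x t) (∫ t in a..b, p t * _root_.pdx f x t) x := by
  have hcont : Continuous fun z : ℝ × ℝ => p z.2 * _root_.pdx f z.1 z.2 :=
    (hp.comp continuous_snd).mul (ContDiff.continuous hf.pdx)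
  obtain ⟨K, hK⟩ := ((isCompact_closedBall x 1).prod (isCompact_uIcc (a := a) (b := b))
    ).exists_bound_of_continuousOn hcont.continuousOn
  refine (hasDerivAt_integral_of_dominated_loc_of_deriv_le (bound := fun _ => K)
    (F := fun x t => p t * f x t) (F' := fun x t => p t * _root_.pdx f x t)
    (Metric.closedBall_mem_nhds x one_pos)
    (Filter.Eventually.of_forall fun z =>
      (hp.mul (hf.continuous_right z)).aestronglyMeasurable)
    ((hp.mul (hf.continuous_right x)).intervalIntegrable _ _)
    (hp.mul (hf.pdx.continuous_right x)).aestronglyMeasurable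
    (Filter.Eventually.of_forall fun t ht z hz => hK (z, t) ⟨hz, Set.uIoc_subset_uIcc ht⟩)
    (by simp)
    (Filter.Eventually.of_forall fun t _ z _ => (hf.hasDerivAt_left z t).const_mul (p t))).2

/-- A nonnegative continuous function with uniformly bounded integrals over unit intervals is
integrable against `1 / (1 + x²)`. -/
theorem integrable_mul_inv_one_add_sq {E : ℝ → ℝ} (hE : Continuous E) (hE0 : ∀ x, 0 ≤ E x)
    {M : ℝ} (hM : ∀ a : ℝ, ∫ x in a..(a + 1), E x ≤ M) :
    Integrable fun x => E x * (1 + x ^ 2)⁻¹ := by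
  have hpos : ∀ x : ℝ, 0 < 1 + x ^ 2 := fun x => by positivity
  have hcont : Continuous fun x : ℝ => E x * (1 + x ^ 2)⁻¹ :=
    hE.mul (Continuous.inv₀ (by fun_prop) fun x => (hpos x).ne')
  have hle : ∀ n : ℤ, ∫ x in Set.Ioc (n : ℝ) (n + 1), ‖E x * (1 + x ^ 2)⁻¹‖
      ≤ M * (3 * (1 + (n : ℝ) ^ 2)⁻¹) := by
    intro n
    rw [← integral_of_le (by linarith)]
    calc ∫ x in (n : ℝ)..(n + 1), ‖E x * (1 + x ^ 2)⁻¹‖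
        ≤ ∫ x in (n : ℝ)..(n + 1), E x * (3 * (1 + (n : ℝ) ^ 2)⁻¹) := by
          refine integral_mono_on (by linarith) (hcont.norm.intervalIntegrable _ _)
            ((hE.mul continuous_const).intervalIntegrable _ _) fun x hx => ?_
          rw [Real.norm_of_nonneg (mul_nonneg (hE0 x) (inv_nonneg.2 (hpos x).le))]
          refine mul_le_mul_of_nonneg_left ?_ (hE0 x)
          rw [← div_eq_mul_inv, inv_eq_one_div, div_le_div_iff₀ (hpos x) (hpos n)]
          nlinarith [hx.1, hx.2, sq_nonneg (2 * x - n), sq_nonneg (x - n)]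
      _ = (∫ x in (n : ℝ)..(n + 1), E x) * (3 * (1 + (n : ℝ) ^ 2)⁻¹) := integral_mul_const _ _
      _ ≤ _ := mul_le_mul_of_nonneg_right (hM n) (by have := hpos n; positivity)
  have hsum : Summable fun n : ℤ => M * (3 * (1 + (n : ℝ) ^ 2)⁻¹) := by
    refine Summable.mul_left _ (Summable.mul_left _ ?_)
    refine Summable.of_norm_bounded_eventually
      (Real.summable_one_div_int_pow.2 one_lt_two) ?_
    have hfin : ({0} : Set ℤ).Finite := Set.finite_singleton 0
    filter_upwards [hfin.compl_mem_cofinite] with n hn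
    have hn' : (n : ℝ) ≠ 0 := by simpa using hn
    rw [Real.norm_of_nonneg (inv_nonneg.2 (hpos n).le), one_div]
    exact inv_anti₀ (by positivity) (by linarith)
  have := integrableOn_iUnion_of_summable_integral_norm (μ := volume)
    (f := fun x => E x * (1 + x ^ 2)⁻¹) (s := fun n : ℤ => Set.Ioc (n : ℝ) (n + 1))
    (fun n => (hcont.integrableOn_Icc).mono_set Set.Ioc_subset_Icc_self)
    (Summable.of_nonneg_of_le (fun n => integral_nonneg fun x => norm_nonneg _) hle hsum)
  rwa [iUnion_Ioc_intCast, integrableOn_univ] at this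

/-- A sequence of successive derivatives whose growth is that of a band-limited function with
quadratic decay. -/
structure IsBandLimitedFamily (v : ℕ → ℝ → ℝ) (B R : ℝ) : Prop where
  hasDerivAt : ∀ n x, HasDerivAt (v n) (v (n + 1) x) x
  bound : ∀ n x, |v n x| ≤ B * R ^ n * (1 + x ^ 2)⁻¹

namespace IsBandLimitedFamily

variable {v : ℕ → ℝ → ℝ} {B R : ℝ}

theorem continuous (hv : IsBandLimitedFamily v B R) (n : ℕ) : Continuous (v n) :=
  continuous_iff_continuousAt.2 fun x => (hv.hasDerivAt n x).continuousAt

theorem integrable_mul (hv : IsBandLimitedFamily v B R) {E f : ℝ → ℝ}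
    (hE : Integrable fun x => E x * (1 + x ^ 2)⁻¹) (hf : Continuous f) {Q : ℝ}
    (hfE : ∀ x, |f x| ≤ Q * E x) (n : ℕ) : Integrable fun x => f x * v n x := by
  refine (hE.const_mul (Q * (B * R ^ n))).mono' (hf.mul (hv.continuous n)).aestronglyMeasurable
    (Filter.Eventually.of_forall fun x => ?_)
  rw [Real.norm_eq_abs, abs_mul]
  calc |f x| * |v n x| ≤ (Q * E x) * (B * R ^ n * (1 + x ^ 2)⁻¹) :=
        mul_le_mul (hfE x) (hv.bound n x) (abs_nonneg _) ((abs_nonneg _).trans (hfE x))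
    _ = _ := by ring

theorem integrable (hv : IsBandLimitedFamily v B R) (n : ℕ) : Integrable (v n) := by
  have := hv.integrable_mul (E := fun _ => 1) (f := fun _ => 1) (Q := 1)
    (by simpa using integrable_inv_one_add_sq) continuous_const (by simp) n
  simpa using this

theorem integral_eq_zero (hv : IsBandLimitedFamily v B R) (h0 : ∫ x, v 0 x = 0) (n : ℕ) :
    ∫ x, v n x = 0 := by
  cases n with
  | zero => exact h0
  | succ n =>
    exact integral_eq_zero_of_hasDerivAt_of_integrable (hv.hasDerivAt n)
      (hv.integrable (n + 1)) (hv.integrable n)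

theorem integral_deriv_mul (hv : IsBandLimitedFamily v B R) {P P' : ℝ → ℝ}
    (hP : ∀ x, HasDerivAt P (P' x) x) {n : ℕ} (h1 : Integrable fun x => P x * v n x)
    (h2 : Integrable fun x => P x * v (n + 1) x) (h3 : Integrable fun x => P' x * v n x) :
    ∫ x, P' x * v n x = -∫ x, P x * v (n + 1) x := by
  rw [integral_mul_deriv_eq_deriv_mul_of_integrable (u := P) (v := v n) (u' := P')
    (v' := v (n + 1)) (fun x _ => hP x) (fun x _ => hv.hasDerivAt n x) h2 h3 h1, neg_neg]

variable {ψ : ℝ → ℝ → ℝ} {B₀ : ℝ}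

theorem integral_intervalIntegral_mul (hv : IsBandLimitedFamily v B R) (hψ : JointlySmooth ψ)
    (hB₀ : ∀ x, ∀ y ∈ Set.Icc (-1 : ℝ) 1, |ψ x y| ≤ B₀) {p : ℝ → ℝ} (hp : Continuous p) {y Q : ℝ}
    (hy : y ∈ Set.Icc (-1 : ℝ) 1) (hQ : ∀ t ∈ Set.Icc (-1 : ℝ) y, |p t| ≤ Q) (n : ℕ) :
    ∫ x, (∫ t in (-1 : ℝ)..y, p t * ψ x t) * v n x
      = ∫ t in (-1 : ℝ)..y, p t * ∫ x, ψ x t * v n x := by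
  simp_rw [integral_of_le hy.1, ← MeasureTheory.integral_mul_const,
    ← MeasureTheory.integral_const_mul]
  rw [integral_integral_swap]
  · simp_rw [mul_assoc]
  · have hg := ((integrable_inv_one_add_sq.const_mul (Q * B₀ * (B * R ^ n))).comp_fst
      (volume.restrict (Set.Ioc (-1 : ℝ) y)))
    refine hg.mono' ?_ ?_
    · have hc : Continuous (Function.uncurry fun x t => p t * ψ x t * v n x) :=
        ((hp.comp continuous_snd).mul (ContDiff.continuous hψ)).mul
          ((hv.continuous n).comp continuous_fst)
      exact hc.aestronglyMeasurable
    · have hmem : ∀ᵐ z : ℝ × ℝ ∂volume.prod (volume.restrict (Set.Ioc (-1 : ℝ) y)),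
          z.2 ∈ Set.Ioc (-1 : ℝ) y :=
        Measure.quasiMeasurePreserving_snd.ae (ae_restrict_mem measurableSet_Ioc)
      filter_upwards [hmem] with z hz
      simp only [Function.uncurry, norm_mul, Real.norm_eq_abs]
      have h1 := hQ z.2 ⟨hz.1.le, hz.2⟩
      have h2 := hB₀ z.1 z.2 ⟨hz.1.le, hz.2.trans hy.2⟩
      have h3 := hv.bound n z.1
      calc |p z.2| * |ψ z.1 z.2| * |v n z.1|
          ≤ (Q * B₀) * (B * R ^ n * (1 + z.1 ^ 2)⁻¹) := by
            have hQ0 := (abs_nonneg _).trans h1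
            have hB0 := (abs_nonneg _).trans h2
            gcongr
        _ = _ := by ring

/-- Pairing the weak wall expansion with a band-limited family of mean zero. -/
theorem integral_mul_eq (hv : IsBandLimitedFamily v B R) (hv0 : ∫ x, v 0 x = 0)
    (hψ : JointlySmooth ψ) (hB₀ : ∀ x, ∀ y ∈ Set.Icc (-1 : ℝ) 1, |ψ x y| ≤ B₀)
    {E : ℝ → ℝ} (hE : Integrable fun x => E x * (1 + x ^ 2)⁻¹)
    (hE1 : ∀ x, ∫ t in (-1 : ℝ)..1, |pdx ψ x t| ≤ E x)
    (hE2 : ∀ x, ∫ t in (-1 : ℝ)..1, |pdx (pdx ψ) x t| ≤ E x)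
    (hE3 : ∀ x, ∫ t in (-1 : ℝ)..1, |pdx (pdx (pdx ψ)) x t| ≤ E x)
    {y k Q : ℝ} (hy : y ∈ Set.Icc (-1 : ℝ) 1) {p₁ p₂ p₃ p₄ : ℝ → ℝ}
    (hp₁ : Continuous p₁) (hp₂ : Continuous p₂) (hp₃ : Continuous p₃) (hp₄ : Continuous p₄)
    (hQ₁ : ∀ t ∈ Set.Icc (-1 : ℝ) y, |p₁ t| ≤ Q) (hQ₂ : ∀ t ∈ Set.Icc (-1 : ℝ) y, |p₂ t| ≤ Q)
    (hQ₃ : ∀ t ∈ Set.Icc (-1 : ℝ) y, |p₃ t| ≤ Q) (hQ₄ : ∀ t ∈ Set.Icc (-1 : ℝ) y, |p₄ t| ≤ Q)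
    (hrep : ∀ x, ψ x y = k + ((∫ t in (-1 : ℝ)..y, p₂ t * pdx (pdx ψ) x t)
      + (∫ t in (-1 : ℝ)..y, p₁ t * pdx ψ x t)
      + (∫ t in (-1 : ℝ)..y, p₄ t * pdx (pdx (pdx (pdx ψ))) x t)
      + ∫ t in (-1 : ℝ)..y, p₃ t * pdx (pdx (pdx ψ)) x t)) (n : ℕ) :
    ∫ x, ψ x y * v n x
      = (∫ t in (-1 : ℝ)..y, p₂ t * ∫ x, ψ x t * v (n + 2) x)
        - (∫ t in (-1 : ℝ)..y, p₁ t * ∫ x, ψ x t * v (n + 1) x)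
        + (∫ t in (-1 : ℝ)..y, p₄ t * ∫ x, ψ x t * v (n + 4) x)
        - ∫ t in (-1 : ℝ)..y, p₃ t * ∫ x, ψ x t * v (n + 3) x := by
  have hQ0 : 0 ≤ Q := (abs_nonneg _).trans (hQ₁ (-1) ⟨le_rfl, hy.1⟩)
  have hone : Integrable fun x : ℝ => (1 : ℝ) * (1 + x ^ 2)⁻¹ := by
    simpa using integrable_inv_one_add_sq
  have hcont : ∀ {f : ℝ → ℝ → ℝ}, JointlySmooth f → ∀ {p : ℝ → ℝ}, Continuous p →
      Continuous fun x => ∫ t in (-1 : ℝ)..y, p t * f x t := fun hf _ hp =>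
    continuous_iff_continuousAt.2 fun x => (hf.hasDerivAt_integral hp _ _ x).continuousAt
  have hbound : ∀ {f : ℝ → ℝ → ℝ}, JointlySmooth f →
      (∀ x, ∫ t in (-1 : ℝ)..1, |f x t| ≤ E x) → ∀ {p : ℝ → ℝ}, Continuous p →
      (∀ t ∈ Set.Icc (-1 : ℝ) y, |p t| ≤ Q) →
      ∀ x, |∫ t in (-1 : ℝ)..y, p t * f x t| ≤ Q * E x := by
    intro f hf hfE p hp hpQ x
    have hfc := (hf.continuous_right x).abs
    calc |∫ t in (-1 : ℝ)..y, p t * f x t| ≤ ∫ t in (-1 : ℝ)..y, |p t * f x t| :=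
          abs_integral_le_integral_abs hy.1
      _ ≤ ∫ t in (-1 : ℝ)..y, Q * |f x t| := by
          refine integral_mono_on hy.1
            ((hp.mul (hf.continuous_right x)).abs.intervalIntegrable _ _)
            ((continuous_const.mul hfc).intervalIntegrable _ _) fun t ht => ?_
          rw [abs_mul]
          exact mul_le_mul_of_nonneg_right (hpQ t ht) (abs_nonneg _)
      _ = Q * ∫ t in (-1 : ℝ)..y, |f x t| := intervalIntegral.integral_const_mul _ _
      _ ≤ Q * ∫ t in (-1 : ℝ)..1, |f x t| := by
          refine mul_le_mul_of_nonneg_left ?_ hQ0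
          refine integral_mono_interval le_rfl hy.1 hy.2 ?_ (hfc.intervalIntegrable _ _)
          exact Filter.Eventually.of_forall fun t => abs_nonneg _
      _ ≤ Q * E x := mul_le_mul_of_nonneg_left (hfE x) hQ0
  have int0 : ∀ {p : ℝ → ℝ}, Continuous p → (∀ t ∈ Set.Icc (-1 : ℝ) y, |p t| ≤ Q) → ∀ m,
      Integrable fun x => (∫ t in (-1 : ℝ)..y, p t * ψ x t) * v m x := by
    intro p hp hpQ m
    refine hv.integrable_mul hone (hcont hψ hp) (Q := Q * B₀ * |y - (-1)|) (fun x => ?_) m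
    rw [mul_one, ← Real.norm_eq_abs]
    refine norm_integral_le_of_norm_le_const fun t ht => ?_
    rw [Set.uIoc_of_le hy.1] at ht
    rw [norm_mul]
    exact mul_le_mul (hpQ t ⟨ht.1.le, ht.2⟩) (hB₀ x t ⟨ht.1.le, ht.2.trans hy.2⟩)
      (norm_nonneg _) hQ0
  have int1 : ∀ {p : ℝ → ℝ}, Continuous p → (∀ t ∈ Set.Icc (-1 : ℝ) y, |p t| ≤ Q) → ∀ m,
      Integrable fun x => (∫ t in (-1 : ℝ)..y, p t * pdx ψ x t) * v m x :=
    fun hp hpQ => hv.integrable_mul hE (hcont hψ.pdx hp) (hbound hψ.pdx hE1 hp hpQ)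
  have int2 : ∀ {p : ℝ → ℝ}, Continuous p → (∀ t ∈ Set.Icc (-1 : ℝ) y, |p t| ≤ Q) → ∀ m,
      Integrable fun x => (∫ t in (-1 : ℝ)..y, p t * pdx (pdx ψ) x t) * v m x :=
    fun hp hpQ => hv.integrable_mul hE (hcont hψ.pdx.pdx hp) (hbound hψ.pdx.pdx hE2 hp hpQ)
  have int3 : ∀ {p : ℝ → ℝ}, Continuous p → (∀ t ∈ Set.Icc (-1 : ℝ) y, |p t| ≤ Q) → ∀ m,
      Integrable fun x => (∫ t in (-1 : ℝ)..y, p t * pdx (pdx (pdx ψ)) x t) * v m x :=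
    fun hp hpQ => hv.integrable_mul hE (hcont hψ.pdx.pdx.pdx hp)
      (hbound hψ.pdx.pdx.pdx hE3 hp hpQ)
  have intψ : ∀ m, Integrable fun x => ψ x y * v m x := fun m =>
    hv.integrable_mul hone (hψ.continuous_left y) (Q := B₀) (fun x => by
      simpa using hB₀ x y hy) m
  have intk : ∀ m, Integrable fun x => k * v m x := fun m => (hv.integrable m).const_mul k
  have int4 : Integrable
      fun x => (∫ t in (-1 : ℝ)..y, p₄ t * pdx (pdx (pdx (pdx ψ))) x t) * v n x := by
    refine (((((intψ n).sub (intk n)).sub (int2 hp₂ hQ₂ n)).sub (int1 hp₁ hQ₁ n)).sub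
      (int3 hp₃ hQ₃ n)).congr (Filter.Eventually.of_forall fun x => ?_)
    simp only [Pi.sub_apply]
    rw [hrep x]
    ring
  have step0 : ∀ {p : ℝ → ℝ}, Continuous p → (∀ t ∈ Set.Icc (-1 : ℝ) y, |p t| ≤ Q) → ∀ m,
      ∫ x, (∫ t in (-1 : ℝ)..y, p t * pdx ψ x t) * v m x
        = -∫ t in (-1 : ℝ)..y, p t * ∫ x, ψ x t * v (m + 1) x := by
    intro p hp hpQ m
    rw [hv.integral_deriv_mul (hψ.hasDerivAt_integral hp _ _) (int0 hp hpQ m)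
      (int0 hp hpQ (m + 1)) (int1 hp hpQ m),
      hv.integral_intervalIntegral_mul hψ hB₀ hp hy hpQ]
  have step1 : ∀ {p : ℝ → ℝ}, Continuous p → (∀ t ∈ Set.Icc (-1 : ℝ) y, |p t| ≤ Q) → ∀ m,
      ∫ x, (∫ t in (-1 : ℝ)..y, p t * pdx (pdx ψ) x t) * v m x
        = ∫ t in (-1 : ℝ)..y, p t * ∫ x, ψ x t * v (m + 2) x := by
    intro p hp hpQ m
    rw [hv.integral_deriv_mul (hψ.pdx.hasDerivAt_integral hp _ _) (int1 hp hpQ m)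
      (int1 hp hpQ (m + 1)) (int2 hp hpQ m), step0 hp hpQ, neg_neg]
  have step2 : ∀ {p : ℝ → ℝ}, Continuous p → (∀ t ∈ Set.Icc (-1 : ℝ) y, |p t| ≤ Q) → ∀ m,
      ∫ x, (∫ t in (-1 : ℝ)..y, p t * pdx (pdx (pdx ψ)) x t) * v m x
        = -∫ t in (-1 : ℝ)..y, p t * ∫ x, ψ x t * v (m + 3) x := by
    intro p hp hpQ m
    rw [hv.integral_deriv_mul (hψ.pdx.pdx.hasDerivAt_integral hp _ _) (int2 hp hpQ m)
      (int2 hp hpQ (m + 1)) (int3 hp hpQ m), step1 hp hpQ]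
  have step3 : ∫ x, (∫ t in (-1 : ℝ)..y, p₄ t * pdx (pdx (pdx (pdx ψ))) x t) * v n x
        = ∫ t in (-1 : ℝ)..y, p₄ t * ∫ x, ψ x t * v (n + 4) x := by
    rw [hv.integral_deriv_mul (hψ.pdx.pdx.pdx.hasDerivAt_integral hp₄ _ _) (int3 hp₄ hQ₄ n)
      (int3 hp₄ hQ₄ (n + 1)) int4, step2 hp₄ hQ₄, neg_neg]
  have hsum : (fun x => ψ x y * v n x) = (fun x => k * v n x)
      + ((((fun x => (∫ t in (-1 : ℝ)..y, p₂ t * pdx (pdx ψ) x t) * v n x)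
      + fun x => (∫ t in (-1 : ℝ)..y, p₁ t * pdx ψ x t) * v n x)
      + fun x => (∫ t in (-1 : ℝ)..y, p₄ t * pdx (pdx (pdx (pdx ψ))) x t) * v n x)
      + fun x => (∫ t in (-1 : ℝ)..y, p₃ t * pdx (pdx (pdx ψ)) x t) * v n x) := by
    funext x
    simp only [Pi.add_apply]
    rw [hrep x]
    ring
  rw [hsum, integral_add' (intk n) ((((int2 hp₂ hQ₂ n).add (int1 hp₁ hQ₁ n)).add int4).add
      (int3 hp₃ hQ₃ n)),
    integral_add' (((int2 hp₂ hQ₂ n).add (int1 hp₁ hQ₁ n)).add int4) (int3 hp₃ hQ₃ n),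
    integral_add' ((int2 hp₂ hQ₂ n).add (int1 hp₁ hQ₁ n)) int4,
    integral_add' (int2 hp₂ hQ₂ n) (int1 hp₁ hQ₁ n),
    MeasureTheory.integral_const_mul, hv.integral_eq_zero hv0, step0 hp₁ hQ₁, step1 hp₂ hQ₂,
    step2 hp₃ hQ₃, step3]
  ring

end IsBandLimitedFamily

/-- A scale of bounded functions satisfying homogeneous Volterra relations with a shift in the
scale vanishes, provided its growth along the scale is geometric. -/
theorem eq_zero_of_volterra_scale {U : ℕ → ℝ → ℝ} {B R Q : ℝ} (hR : 1 ≤ R) (hQ : 0 ≤ Q)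
    {p₁ p₂ p₃ p₄ : ℝ → ℝ → ℝ}
    (hQ₁ : ∀ y ∈ Set.Icc (-1 : ℝ) 1, ∀ t ∈ Set.Icc (-1 : ℝ) y, |p₁ y t| ≤ Q)
    (hQ₂ : ∀ y ∈ Set.Icc (-1 : ℝ) 1, ∀ t ∈ Set.Icc (-1 : ℝ) y, |p₂ y t| ≤ Q)
    (hQ₃ : ∀ y ∈ Set.Icc (-1 : ℝ) 1, ∀ t ∈ Set.Icc (-1 : ℝ) y, |p₃ y t| ≤ Q)
    (hQ₄ : ∀ y ∈ Set.Icc (-1 : ℝ) 1, ∀ t ∈ Set.Icc (-1 : ℝ) y, |p₄ y t| ≤ Q)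
    (hU : ∀ n, ∀ y ∈ Set.Icc (-1 : ℝ) 1, |U n y| ≤ B * R ^ n)
    (hrec : ∀ n, ∀ y ∈ Set.Icc (-1 : ℝ) 1, U n y
      = (∫ t in (-1 : ℝ)..y, p₂ y t * U (n + 2) t) - (∫ t in (-1 : ℝ)..y, p₁ y t * U (n + 1) t)
        + (∫ t in (-1 : ℝ)..y, p₄ y t * U (n + 4) t)
        - ∫ t in (-1 : ℝ)..y, p₃ y t * U (n + 3) t) {y : ℝ} (hy : y ∈ Set.Icc (-1 : ℝ) 1) :
    U 0 y = 0 := by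
  have hB : 0 ≤ B := by simpa using (abs_nonneg _).trans (hU 0 y hy)
  set μ : ℝ := 8 * Q * R ^ 4 + 1 with hμ
  have hμ0 : 0 < μ := by positivity
  have hexp : ∀ y : ℝ, ∫ t in (-1 : ℝ)..y, Real.exp (μ * (t + 1))
      ≤ Real.exp (μ * (y + 1)) / μ := by
    intro y
    have hd : ∀ t : ℝ, HasDerivAt (fun t => Real.exp (μ * (t + 1)) / μ)
        (Real.exp (μ * (t + 1))) t := by
      intro t
      have := ((((hasDerivAt_id t).add_const 1).const_mul μ).exp.div_const μ)
      simpa [hμ0.ne'] using this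
    rw [integral_eq_sub_of_hasDerivAt (fun t _ => hd t)
      (Continuous.intervalIntegrable (by fun_prop) _ _)]
    have : 0 < Real.exp (μ * (-1 + 1)) / μ := by positivity
    linarith
  have key : ∀ j n : ℕ, ∀ y ∈ Set.Icc (-1 : ℝ) 1,
      |U n y| ≤ B * (1 / 2) ^ j * R ^ n * Real.exp (μ * (y + 1)) := by
    intro j
    induction j with
    | zero =>
      intro n y hy
      refine (hU n y hy).trans ?_
      rw [pow_zero, mul_one]
      refine le_mul_of_one_le_right (by positivity) (Real.one_le_exp ?_)
      have := hy.1
      exact mul_nonneg hμ0.le (by linarith)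
    | succ j ih =>
      intro n y hy
      have term : ∀ (p : ℝ → ℝ → ℝ) (i : ℕ), i ≤ 4 →
          (∀ y ∈ Set.Icc (-1 : ℝ) 1, ∀ t ∈ Set.Icc (-1 : ℝ) y, |p y t| ≤ Q) →
          |∫ t in (-1 : ℝ)..y, p y t * U (n + i) t|
            ≤ Q * (B * (1 / 2) ^ j * R ^ n * R ^ 4) * (Real.exp (μ * (y + 1)) / μ) := by
        intro p i hi hp
        have h1 : ‖∫ t in (-1 : ℝ)..y, p y t * U (n + i) t‖
            ≤ ∫ t in (-1 : ℝ)..y, Q * (B * (1 / 2) ^ j * R ^ n * R ^ 4)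
              * Real.exp (μ * (t + 1)) := by
          refine norm_integral_le_of_norm_le hy.1 (Filter.Eventually.of_forall fun t ht => ?_)
            (Continuous.intervalIntegrable (by fun_prop) _ _)
          rw [norm_mul, mul_assoc]
          refine mul_le_mul (hp y hy t ⟨ht.1.le, ht.2⟩) ?_ (norm_nonneg _) hQ
          refine (ih (n + i) t ⟨ht.1.le, ht.2.trans hy.2⟩).trans ?_
          rw [pow_add, ← mul_assoc]
          gcongr
        rw [intervalIntegral.integral_const_mul] at h1
        exact h1.trans (mul_le_mul_of_nonneg_left (hexp y) (by positivity))
      have t1 := abs_le.1 (term p₁ 1 (by norm_num) hQ₁)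
      have t2 := abs_le.1 (term p₂ 2 (by norm_num) hQ₂)
      have t3 := abs_le.1 (term p₃ 3 (by norm_num) hQ₃)
      have t4 := abs_le.1 (term p₄ 4 (by norm_num) hQ₄)
      have hfin : 4 * (Q * (B * (1 / 2) ^ j * R ^ n * R ^ 4) * (Real.exp (μ * (y + 1)) / μ))
          ≤ B * (1 / 2) ^ (j + 1) * R ^ n * Real.exp (μ * (y + 1)) := by
        have h8 : 4 * Q * R ^ 4 / μ ≤ 1 / 2 := by
          rw [div_le_div_iff₀ hμ0 two_pos, hμ]
          linarith
        calc _ = (B * (1 / 2) ^ j * R ^ n * Real.exp (μ * (y + 1))) * (4 * Q * R ^ 4 / μ) := by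
              ring
          _ ≤ (B * (1 / 2) ^ j * R ^ n * Real.exp (μ * (y + 1))) * (1 / 2) :=
              mul_le_mul_of_nonneg_left h8 (by positivity)
          _ = _ := by ring
      rw [hrec n y hy, abs_le]
      constructor <;> linarith [t1.1, t1.2, t2.1, t2.2, t3.1, t3.2, t4.1, t4.2]
  have hlim : Filter.Tendsto
      (fun j : ℕ => B * (1 / 2 : ℝ) ^ j * R ^ 0 * Real.exp (μ * (y + 1))) Filter.atTop
      (nhds 0) := by
    have h := tendsto_pow_atTop_nhds_zero_of_lt_one (r := (1 / 2 : ℝ)) (by norm_num)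
      (by norm_num)
    simpa using (h.const_mul B).mul_const (Real.exp (μ * (y + 1)))
  exact abs_nonpos_iff.1 (ge_of_tendsto' hlim fun j => key j 0 y hy)

/-- A bounded solution of the wall expansion is orthogonal to band-limited functions of mean
zero. -/
theorem IsBandLimitedFamily.integral_mul_eq_zero {v : ℕ → ℝ → ℝ} {B R : ℝ}
    (hv : IsBandLimitedFamily v B R) (hR : 1 ≤ R) (hv0 : ∫ x, v 0 x = 0)
    {ψ : ℝ → ℝ → ℝ} (hψ : JointlySmooth ψ) {B₀ : ℝ}
    (hB₀ : ∀ x, ∀ y ∈ Set.Icc (-1 : ℝ) 1, |ψ x y| ≤ B₀)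
    {E : ℝ → ℝ} (hE : Integrable fun x => E x * (1 + x ^ 2)⁻¹)
    (hE1 : ∀ x, ∫ t in (-1 : ℝ)..1, |pdx ψ x t| ≤ E x)
    (hE2 : ∀ x, ∫ t in (-1 : ℝ)..1, |pdx (pdx ψ) x t| ≤ E x)
    (hE3 : ∀ x, ∫ t in (-1 : ℝ)..1, |pdx (pdx (pdx ψ)) x t| ≤ E x)
    {k : ℝ → ℝ} {p₁ p₂ p₃ p₄ : ℝ → ℝ → ℝ}
    (hp₁ : Continuous (Function.uncurry p₁)) (hp₂ : Continuous (Function.uncurry p₂))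
    (hp₃ : Continuous (Function.uncurry p₃)) (hp₄ : Continuous (Function.uncurry p₄))
    (hrep : ∀ x, ∀ y ∈ Set.Icc (-1 : ℝ) 1,
      ψ x y = k y + ((∫ t in (-1 : ℝ)..y, p₂ y t * pdx (pdx ψ) x t)
      + (∫ t in (-1 : ℝ)..y, p₁ y t * pdx ψ x t)
      + (∫ t in (-1 : ℝ)..y, p₄ y t * pdx (pdx (pdx (pdx ψ))) x t)
      + ∫ t in (-1 : ℝ)..y, p₃ y t * pdx (pdx (pdx ψ)) x t))
    {y : ℝ} (hy : y ∈ Set.Icc (-1 : ℝ) 1) :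
    ∫ x, ψ x y * v 0 x = 0 := by
  have hbd : ∀ {p : ℝ → ℝ → ℝ}, Continuous (Function.uncurry p) →
      ∃ K, ∀ y ∈ Set.Icc (-1 : ℝ) 1, ∀ t ∈ Set.Icc (-1 : ℝ) y, |p y t| ≤ K := by
    intro p hp
    obtain ⟨K, hK⟩ := ((isCompact_Icc (a := (-1 : ℝ)) (b := 1)).prod
      (isCompact_Icc (a := (-1 : ℝ)) (b := 1))).exists_bound_of_continuousOn hp.continuousOn
    exact ⟨K, fun y hy t ht => hK (y, t) ⟨hy, ht.1, ht.2.trans hy.2⟩⟩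
  obtain ⟨K₁, hK₁⟩ := hbd hp₁
  obtain ⟨K₂, hK₂⟩ := hbd hp₂
  obtain ⟨K₃, hK₃⟩ := hbd hp₃
  obtain ⟨K₄, hK₄⟩ := hbd hp₄
  set Q : ℝ := |K₁| + |K₂| + |K₃| + |K₄| with hQ
  have n1 := abs_nonneg K₁
  have n2 := abs_nonneg K₂
  have n3 := abs_nonneg K₃
  have n4 := abs_nonneg K₄
  have l1 := le_abs_self K₁
  have l2 := le_abs_self K₂
  have l3 := le_abs_self K₃
  have l4 := le_abs_self K₄
  have hQ₁ : ∀ y ∈ Set.Icc (-1 : ℝ) 1, ∀ t ∈ Set.Icc (-1 : ℝ) y, |p₁ y t| ≤ Q :=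
    fun y hy t ht => (hK₁ y hy t ht).trans (by linarith)
  have hQ₂ : ∀ y ∈ Set.Icc (-1 : ℝ) 1, ∀ t ∈ Set.Icc (-1 : ℝ) y, |p₂ y t| ≤ Q :=
    fun y hy t ht => (hK₂ y hy t ht).trans (by linarith)
  have hQ₃ : ∀ y ∈ Set.Icc (-1 : ℝ) 1, ∀ t ∈ Set.Icc (-1 : ℝ) y, |p₃ y t| ≤ Q :=
    fun y hy t ht => (hK₃ y hy t ht).trans (by linarith)
  have hQ₄ : ∀ y ∈ Set.Icc (-1 : ℝ) 1, ∀ t ∈ Set.Icc (-1 : ℝ) y, |p₄ y t| ≤ Q :=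
    fun y hy t ht => (hK₄ y hy t ht).trans (by linarith)
  have hslice : ∀ {p : ℝ → ℝ → ℝ}, Continuous (Function.uncurry p) → ∀ y, Continuous (p y) :=
    fun hp y => hp.comp (Continuous.prodMk_right y)
  refine eq_zero_of_volterra_scale (U := fun n y => ∫ x, ψ x y * v n x)
    (B := B₀ * B * ∫ x : ℝ, (1 + x ^ 2)⁻¹) hR (by positivity) hQ₁ hQ₂ hQ₃ hQ₄ ?_ ?_ hy
  · intro n y hy
    have h1 : ‖∫ x, ψ x y * v n x‖ ≤ ∫ x : ℝ, B₀ * (B * R ^ n) * (1 + x ^ 2)⁻¹ := by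
      refine norm_integral_le_of_norm_le (integrable_inv_one_add_sq.const_mul _)
        (Filter.Eventually.of_forall fun x => ?_)
      rw [norm_mul, mul_assoc]
      exact mul_le_mul (hB₀ x y hy) (hv.bound n x) (norm_nonneg _)
        ((abs_nonneg _).trans (hB₀ x y hy))
    rw [MeasureTheory.integral_const_mul] at h1
    exact h1.trans_eq (by ring)
  · intro n y hy
    exact hv.integral_mul_eq hv0 hψ hB₀ hE hE1 hE2 hE3 hy (hslice hp₁ y) (hslice hp₂ y)
      (hslice hp₃ y) (hslice hp₄ y) (hQ₁ y hy) (hQ₂ y hy) (hQ₃ y hy) (hQ₄ y hy)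
      (fun x => hrep x y hy) n

open scoped FourierTransform

/-- The Fourier transform of a smooth bump function gives a band-limited family of mean one. -/
theorem exists_isBandLimitedFamily_integral_eq_one :
    ∃ (v : ℕ → ℝ → ℝ) (B R : ℝ), IsBandLimitedFamily v B R ∧ 1 ≤ R ∧ ∫ x, v 0 x = 1 := by
  let η : ContDiffBump (0 : ℝ) := ⟨1 / 2, 1, by norm_num, by norm_num⟩
  have hsupp : HasCompactSupport fun x : ℝ => (η x : ℂ) :=
    η.hasCompactSupport.comp_left (g := fun r : ℝ => (r : ℂ)) Complex.ofReal_zero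
  have hsm : ContDiff ℝ (⊤ : ℕ∞) fun x : ℝ => (η x : ℂ) :=
    Complex.ofRealCLM.contDiff.comp η.contDiff
  let g : SchwartzMap ℝ ℂ := hsupp.toSchwartzMap hsm
  have hgη : ∀ x, g x = (η x : ℂ) := fun x => rfl
  have hts : tsupport g ⊆ Metric.closedBall 0 1 := by
    refine closure_minimal (fun x hx => ?_) Metric.isClosed_closedBall
    have h1 : (η x : ℂ) ≠ 0 := hx
    have h2 : x ∈ Function.support η := fun h => h1 (by rw [h, Complex.ofReal_zero])
    rw [η.support_eq] at h2
    exact Metric.ball_subset_closedBall h2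
  have hinteg : ∀ k p : ℕ, Integrable fun x => ‖x‖ ^ k * ‖iteratedFDeriv ℝ p g x‖ :=
    fun k p => g.integrable_pow_mul_iteratedFDeriv volume k p
  have hinteg0 : ∀ p : ℕ, Integrable fun x => ‖iteratedFDeriv ℝ p g x‖ := fun p => by
    simpa using hinteg 0 p
  let J : ℕ → ℝ := fun p => ∫ x, ‖iteratedFDeriv ℝ p g x‖
  have hJ0 : ∀ p, 0 ≤ J p := fun p => integral_nonneg fun x => norm_nonneg _
  have hJ : ∀ k p : ℕ, ∫ x, ‖x‖ ^ k * ‖iteratedFDeriv ℝ p g x‖ ≤ J p := by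
    intro k p
    refine integral_mono (hinteg k p) (hinteg0 p) fun x => ?_
    by_cases hx : x ∈ tsupport g
    · have h1 : ‖x‖ ≤ 1 := by simpa using hts hx
      exact mul_le_of_le_one_left (norm_nonneg _) (pow_le_one₀ (norm_nonneg _) h1)
    · have h2 : iteratedFDeriv ℝ p g x = 0 := by
        by_contra h
        exact hx (support_iteratedFDeriv_subset p h)
      simp [h2]
  set T : ℝ := J 0 + J 1 + J 2 with hT
  have hT0 : 0 ≤ T := add_nonneg (add_nonneg (hJ0 0) (hJ0 1)) (hJ0 2)
  have hJT : ∀ p ≤ 2, J p ≤ T := by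
    intro p hp
    have h0 := hJ0 0
    have h1 := hJ0 1
    have h2 := hJ0 2
    interval_cases p <;> linarith
  let G : SchwartzMap ℝ ℂ := 𝓕 g
  have hG : (G : ℝ → ℂ) = 𝓕 (g : ℝ → ℂ) := SchwartzMap.fourier_coe g
  have hfour : ∀ k n : ℕ, n ≤ 2 → ∀ w : ℝ, ‖w‖ ^ n * ‖iteratedDeriv k G w‖
      ≤ (2 * Real.pi) ^ k * (2 * k + 2) ^ n * (((k + 1) * (n + 1)) * T) := by
    intro k n hn w
    rw [← norm_iteratedFDeriv_eq_norm_iteratedDeriv, hG]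
    refine (Real.pow_mul_norm_iteratedFDeriv_fourier_le (K := ⊤) (N := ⊤) (g.smooth ⊤)
      (fun k n _ _ => hinteg k n) le_top le_top w).trans ?_
    refine mul_le_mul_of_nonneg_left ?_ (by positivity)
    refine (Finset.sum_le_card_nsmul _ _ T fun p hp => ?_).trans_eq ?_
    · rw [Finset.mem_product, Finset.mem_range, Finset.mem_range] at hp
      exact (hJ p.1 p.2).trans (hJT p.2 (by omega))
    · simp
  have hcube : ∀ k : ℕ, ((k : ℝ) + 1) ^ 3 ≤ 8 ^ k := by
    intro k
    have h1 : (k : ℝ) + 1 ≤ 2 ^ k := by exact_mod_cast Nat.lt_two_pow_self (n := k)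
    calc ((k : ℝ) + 1) ^ 3 ≤ (2 ^ k) ^ 3 := by gcongr
      _ = 8 ^ k := by rw [← pow_mul, mul_comm, pow_mul]; norm_num
  have hsmooth : ContDiff ℝ (⊤ : ℕ∞) G := G.smooth ⊤
  refine ⟨fun n x => (iteratedDeriv n G x).re, 13 * T, 16 * Real.pi, ⟨?_, ?_⟩, ?_, ?_⟩
  · intro n x
    have hd : HasDerivAt (iteratedDeriv n G) (iteratedDeriv (n + 1) G x) x := by
      rw [iteratedDeriv_succ]
      exact ((hsmooth.differentiable_iteratedDeriv n (by exact_mod_cast WithTop.coe_lt_top _))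
        x).hasDerivAt
    exact Complex.reCLM.hasFDerivAt.comp_hasDerivAt x hd
  · intro n x
    have hx : 0 < 1 + x ^ 2 := by positivity
    rw [← div_eq_mul_inv, le_div_iff₀ hx]
    have h0 := hfour n 0 (by norm_num) x
    have h2 := hfour n 2 le_rfl x
    have hre := Complex.abs_re_le_norm (iteratedDeriv n G x)
    have hc := hcube n
    have hn : (n : ℝ) + 1 ≤ (n + 1) ^ 3 := by
      have : (0 : ℝ) ≤ n := n.cast_nonneg
      nlinarith [pow_nonneg this 3, pow_nonneg this 2]
    rw [Real.norm_eq_abs, sq_abs] at h2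
    calc |(iteratedDeriv n G x).re| * (1 + x ^ 2)
        ≤ ‖iteratedDeriv n G x‖ * (1 + x ^ 2) := mul_le_mul_of_nonneg_right hre hx.le
      _ ≤ (2 * Real.pi) ^ n * T * (12 * (n + 1) ^ 3 + (n + 1)) := by
          norm_num at h0 h2
          linarith
      _ ≤ (2 * Real.pi) ^ n * T * (13 * 8 ^ n) := by
          refine mul_le_mul_of_nonneg_left (by linarith) (by positivity)
      _ = 13 * T * (16 * Real.pi) ^ n := by
          rw [show (16 : ℝ) * Real.pi = (2 * Real.pi) * 8 by ring, mul_pow _ 8]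
          ring
  · linarith [Real.pi_gt_three]
  · have hF : 𝓕⁻ (𝓕 (g : ℝ → ℂ)) = g :=
      g.continuous.fourierInv_fourier_eq g.integrable
        (by rw [← hG]; exact G.integrable)
    have h0 := congrFun hF 0
    rw [Real.fourierInv_eq'] at h0
    simp only [inner_zero_right, mul_zero, Complex.ofReal_zero, zero_mul, Complex.exp_zero,
      one_smul] at h0
    have hη : η 0 = 1 := η.one_of_mem_closedBall (by simp [η])
    rw [hgη, hη, ← hG] at h0
    simp only [iteratedDeriv_zero]
    have := integral_re (μ := volume) (𝕜 := ℂ) (f := G) G.integrable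
    simp only [RCLike.re_to_complex] at this
    rw [this, h0, Complex.ofReal_one, Complex.one_re]

namespace IsBandLimitedFamily

theorem sub {v w : ℕ → ℝ → ℝ} {B B' R : ℝ} (hv : IsBandLimitedFamily v B R)
    (hw : IsBandLimitedFamily w B' R) :
    IsBandLimitedFamily (fun n x => v n x - w n x) (B + B') R where
  hasDerivAt n x := (hv.hasDerivAt n x).sub (hw.hasDerivAt n x)
  bound n x := by
    refine (abs_sub _ _).trans ((add_le_add (hv.bound n x) (hw.bound n x)).trans_eq ?_)
    ring

theorem rescale {v : ℕ → ℝ → ℝ} {B R : ℝ} (hv : IsBandLimitedFamily v B R) (hR : 0 ≤ R) {l : ℝ}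
    (hl : 1 ≤ l) (x₀ : ℝ) :
    IsBandLimitedFamily (fun n x => l ^ (n + 1) * v n (l * (x - x₀)))
      (l * B * (2 * (1 + x₀ ^ 2))) (l * R) where
  hasDerivAt n x := by
    have h1 : HasDerivAt (fun x => l * (x - x₀)) l x := by
      simpa using ((hasDerivAt_id x).sub_const x₀).const_mul l
    have h2 := ((hv.hasDerivAt n (l * (x - x₀))).comp x h1).const_mul (l ^ (n + 1))
    refine h2.congr_deriv ?_
    ring
  bound n x := by
    have hB : 0 ≤ B := by simpa using (abs_nonneg _).trans (hv.bound 0 0)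
    have hl0 : 0 ≤ l := zero_le_one.trans hl
    have hw : (1 + (l * (x - x₀)) ^ 2)⁻¹ ≤ 2 * (1 + x₀ ^ 2) * (1 + x ^ 2)⁻¹ := by
      rw [← div_eq_mul_inv, inv_eq_one_div, div_le_div_iff₀ (by positivity) (by positivity)]
      have h1 : (x - x₀) ^ 2 ≤ (l * (x - x₀)) ^ 2 := by
        rw [mul_pow]
        exact le_mul_of_one_le_left (sq_nonneg _) (one_le_pow₀ hl)
      have h2 : 0 ≤ x₀ ^ 2 * (l * (x - x₀)) ^ 2 := by positivity
      nlinarith [sq_nonneg (x - 2 * x₀), sq_nonneg x₀]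
    rw [abs_mul, abs_of_nonneg (pow_nonneg hl0 _)]
    calc l ^ (n + 1) * |v n (l * (x - x₀))|
        ≤ l ^ (n + 1) * (B * R ^ n * (2 * (1 + x₀ ^ 2) * (1 + x ^ 2)⁻¹)) := by
          refine mul_le_mul_of_nonneg_left ((hv.bound n _).trans ?_) (pow_nonneg hl0 _)
          exact mul_le_mul_of_nonneg_left hw (by positivity)
      _ = _ := by rw [mul_pow]; ring

end IsBandLimitedFamily

theorem integral_mul_comp_rescale (f g : ℝ → ℝ) {l : ℝ} (hl : 0 < l) (x₀ : ℝ) :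
    ∫ x, f x * (l * g (l * (x - x₀))) = ∫ t, f (x₀ + t / l) * g t := by
  have h1 := integral_sub_right_eq_self (μ := volume)
    (fun x => f (x₀ + (l * x) / l) * (l * g (l * x))) x₀
  have h2 := Measure.integral_comp_mul_left (fun t => f (x₀ + t / l) * (l * g t)) l
  rw [h2] at h1
  have h3 : (fun x => f x * (l * g (l * (x - x₀))))
      = fun x => f (x₀ + l * (x - x₀) / l) * (l * g (l * (x - x₀))) := by
    funext x
    rw [mul_div_cancel_left₀ _ hl.ne', add_sub_cancel]
  rw [h3, h1, smul_eq_mul, ← MeasureTheory.integral_const_mul, abs_of_pos (inv_pos.2 hl)]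
  congr 1
  funext t
  field_simp

/-- A bounded continuous function orthogonal to all band-limited functions of mean zero is
constant. -/
theorem eq_of_orthogonal_bandLimited {f : ℝ → ℝ} (hf : Continuous f) {B₀ : ℝ}
    (hB₀ : ∀ x, |f x| ≤ B₀)
    (h : ∀ (v : ℕ → ℝ → ℝ) (B R : ℝ), IsBandLimitedFamily v B R → 1 ≤ R → ∫ x, v 0 x = 0 →
      ∫ x, f x * v 0 x = 0) (x₀ x₁ : ℝ) : f x₀ = f x₁ := by
  obtain ⟨K, B, R, hK, hR, hK1⟩ := exists_isBandLimitedFamily_integral_eq_one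
  have hfK : ∀ {w : ℕ → ℝ → ℝ} {B' R' : ℝ}, IsBandLimitedFamily w B' R' →
      Integrable fun x => f x * w 0 x := fun hw =>
    hw.integrable_mul (E := fun _ => 1) (by simpa using integrable_inv_one_add_sq) hf
      (Q := B₀) (by simpa using hB₀) 0
  have hmean : ∀ l : ℝ, 1 ≤ l →
      ∫ t, f (x₀ + t / l) * K 0 t = ∫ t, f (x₁ + t / l) * K 0 t := by
    intro l hl
    have hl0 : 0 < l := zero_lt_one.trans_le hl
    have hw₀ := hK.rescale (zero_le_one.trans hR) hl x₀
    have hw₁ := hK.rescale (zero_le_one.trans hR) hl x₁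
    have hinteg : ∀ x₂, ∫ x, l ^ (0 + 1) * K 0 (l * (x - x₂)) = 1 := by
      intro x₂
      have := integral_mul_comp_rescale (fun _ => 1) (K 0) hl0 x₂
      simpa [hK1] using this
    have hz := h _ _ _ (hw₀.sub hw₁) (one_le_mul_of_one_le_of_one_le hl hR) (by
      rw [integral_sub (hw₀.integrable 0) (hw₁.integrable 0), hinteg, hinteg, sub_self])
    simp only [mul_sub (f _)] at hz
    rw [integral_sub (hfK hw₀) (hfK hw₁)] at hz
    simp only [zero_add, pow_one] at hz
    rw [integral_mul_comp_rescale f (K 0) hl0, integral_mul_comp_rescale f (K 0) hl0] at hz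
    linarith
  have hlim : ∀ x₂, Filter.Tendsto (fun m : ℕ => ∫ t, f (x₂ + t / ((m : ℝ) + 1)) * K 0 t)
      Filter.atTop (nhds (f x₂)) := by
    intro x₂
    have h1 : f x₂ = ∫ t, f x₂ * K 0 t := by
      rw [MeasureTheory.integral_const_mul, hK1, mul_one]
    rw [h1]
    refine tendsto_integral_of_dominated_convergence (fun t => B₀ * |K 0 t|) (fun m => ?_)
      ((hK.integrable 0).abs.const_mul B₀) (fun m => Filter.Eventually.of_forall fun t => ?_)
      (Filter.Eventually.of_forall fun t => ?_)
    · have := hK.continuous 0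
      exact (Continuous.mul (by fun_prop) this).aestronglyMeasurable
    · rw [norm_mul]
      exact mul_le_mul_of_nonneg_right (hB₀ _) (norm_nonneg _)
    · refine Filter.Tendsto.mul_const _ ((hf.tendsto x₂).comp ?_)
      have h2 := (tendsto_one_div_add_atTop_nhds_zero_nat (𝕜 := ℝ)).const_mul t
      simpa [div_eq_mul_inv] using h2.const_add x₂
  refine tendsto_nhds_unique (hlim x₀) ((hlim x₁).congr fun m => ?_)
  exact (hmean _ (by simp)).symm

theorem JointlySmooth.abs_le_of_wall {f : ℝ → ℝ → ℝ} (hf : JointlySmooth f) {x y e : ℝ}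
    (h0 : f x (-1) = 0) (he : ∫ t in (-1 : ℝ)..1, |_root_.pdy f x t| ≤ e)
    (hy : y ∈ Set.Icc (-1 : ℝ) 1) : |f x y| ≤ e := by
  have hc := hf.pdy.continuous_right x
  have h1 := integral_eq_sub_of_hasDerivAt (a := -1) (b := y)
    (fun t _ => hf.hasDerivAt_right x t) (hc.intervalIntegrable _ _)
  rw [h0, sub_zero] at h1
  rw [← h1]
  refine (abs_integral_le_integral_abs hy.1).trans (le_trans ?_ he)
  exact integral_mono_interval le_rfl hy.1 hy.2
    (Filter.Eventually.of_forall fun t => abs_nonneg _) (hc.abs.intervalIntegrable _ _)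

/-- A function dominated, together with its derivative, by a function with bounded unit averages
is bounded. -/
theorem abs_le_of_unit_averages {g g' E : ℝ → ℝ} {M : ℝ} (hg : ∀ x, HasDerivAt g (g' x) x)
    (hg' : Continuous g') (hE : Continuous E) (hgE : ∀ x, |g x| ≤ E x)
    (hgE' : ∀ x, |g' x| ≤ E x) (hM : ∀ a : ℝ, ∫ x in a..(a + 1), E x ≤ M) (a : ℝ) :
    |g a| ≤ 2 * M := by
  have hE0 : ∀ x, 0 ≤ E x := fun x => (abs_nonneg _).trans (hgE x)
  have hpt : ∀ x ∈ Set.Icc a (a + 1), |g a| ≤ E x + M := by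
    intro x hx
    have h1 := integral_eq_sub_of_hasDerivAt (a := a) (b := x) (fun t _ => hg t)
      (hg'.intervalIntegrable _ _)
    have h2 : |∫ t in a..x, g' t| ≤ M := by
      refine (abs_integral_le_integral_abs hx.1).trans (le_trans ?_ (hM a))
      refine (integral_mono_on hx.1 (hg'.abs.intervalIntegrable _ _)
        (hE.intervalIntegrable _ _) fun t _ => hgE' t).trans ?_
      exact integral_mono_interval le_rfl hx.1 hx.2
        (Filter.Eventually.of_forall hE0) (hE.intervalIntegrable _ _)
    rw [h1] at h2
    have h3 := hgE x
    rw [abs_le] at h2 h3 ⊢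
    constructor <;> linarith [h2.1, h2.2, h3.1, h3.2]
  have h4 := integral_mono_on (a := a) (b := a + 1) (by linarith)
    (continuous_const.intervalIntegrable (μ := volume) _ _)
    ((hE.add continuous_const).intervalIntegrable (μ := volume) _ _) hpt
  simp only [Pi.add_apply] at h4
  rw [integral_add (hE.intervalIntegrable _ _) (continuous_const.intervalIntegrable _ _)] at h4
  simp only [intervalIntegral.integral_const, add_sub_cancel_left, one_smul] at h4
  linarith [hM a]

/-- A bounded solution of the linear equation whose wall values of `ψ_yy` and `ψ_yyy` are constant
does not depend on `x`. -/
theorem eq_of_wall_constant {ψ : ℝ → ℝ → ℝ} {A C : ℝ} (hψ : JointlySmooth ψ)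
    (hlin : ∀ x : ℝ, ∀ y ∈ Set.Ioo (-1 : ℝ) 1,
      pdx (pdx (pdx (pdx ψ))) x y + 2 * pdy (pdy (pdx (pdx ψ))) x y
          + pdy (pdy (pdy (pdy ψ))) x y
        - ((3 * A * y ^ 2 + C) * (pdy (pdy (pdx ψ)) x y + pdx (pdx (pdx ψ)) x y)
            - 6 * A * pdx ψ x y) = 0)
    (h0 : ∀ x, ψ x (-1) = 0) (h1 : ∀ x, pdy ψ x (-1) = 0)
    (h2 : ∀ x, pdx (pdy (pdy ψ)) x (-1) = 0) (h3 : ∀ x, pdx (pdy (pdy (pdy ψ))) x (-1) = 0)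
    {B₀ : ℝ} (hB₀ : ∀ x, ∀ y ∈ Set.Icc (-1 : ℝ) 1, |ψ x y| ≤ B₀)
    {E : ℝ → ℝ} (hE : Integrable fun x => E x * (1 + x ^ 2)⁻¹)
    (hE1 : ∀ x, ∫ t in (-1 : ℝ)..1, |pdx ψ x t| ≤ E x)
    (hE2 : ∀ x, ∫ t in (-1 : ℝ)..1, |pdx (pdx ψ) x t| ≤ E x)
    (hE3 : ∀ x, ∫ t in (-1 : ℝ)..1, |pdx (pdx (pdx ψ)) x t| ≤ E x)
    {y : ℝ} (hy : y ∈ Set.Icc (-1 : ℝ) 1) (x₀ x₁ : ℝ) : ψ x₀ y = ψ x₁ y := by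
  have hconst : ∀ {f : ℝ → ℝ → ℝ}, JointlySmooth f → (∀ x, pdx f x (-1) = 0) →
      ∀ x, f x (-1) = f 0 (-1) := fun hf hf0 x =>
    is_const_of_deriv_eq_zero (f := fun t => _)
      (fun t => (hf.hasDerivAt_left t (-1)).differentiableAt) hf0 x 0
  refine eq_of_orthogonal_bandLimited (hψ.continuous_left y) (fun x => hB₀ x y hy)
    (fun v B R hv hR hv0 => ?_) x₀ x₁
  refine hv.integral_mul_eq_zero hR hv0 hψ hB₀ hE hE1 hE2 hE3
    (k := fun y => pdy (pdy ψ) 0 (-1) * ((y + 1) ^ 2 / 2)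
      + pdy (pdy (pdy ψ)) 0 (-1) * ((y + 1) ^ 3 / 6))
    (p₁ := fun y t => (y - t) * (3 * A * t ^ 2 + C) - (y - t) ^ 2 * (6 * A * t))
    (p₂ := fun y t => -2 * (y - t)) (p₃ := fun y t => (y - t) ^ 3 / 6 * (3 * A * t ^ 2 + C))
    (p₄ := fun y t => -(y - t) ^ 3 / 6) ?_ ?_ ?_ ?_ (fun x y hy => ?_) hy
  · unfold Function.uncurry; fun_prop
  · unfold Function.uncurry; fun_prop
  · unfold Function.uncurry; fun_prop
  · unfold Function.uncurry; fun_prop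
  · rw [← hconst hψ.pdy.pdy h2 x, ← hconst hψ.pdy.pdy.pdy h3 x]
    exact wall_taylor hψ hlin h0 h1 x hy

/-- An even solution of the linear equation which vanishes to first order on the walls and does not
depend on `x` is zero. -/
theorem eq_zero_of_translation_invariant {ψ : ℝ → ℝ → ℝ} {A C : ℝ} (hψ : JointlySmooth ψ)
    (hlin : ∀ x : ℝ, ∀ y ∈ Set.Ioo (-1 : ℝ) 1,
      pdx (pdx (pdx (pdx ψ))) x y + 2 * pdy (pdy (pdx (pdx ψ))) x y
          + pdy (pdy (pdy (pdy ψ))) x y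
        - ((3 * A * y ^ 2 + C) * (pdy (pdy (pdx ψ)) x y + pdx (pdx (pdx ψ)) x y)
            - 6 * A * pdx ψ x y) = 0)
    (hsymm : ∀ x y : ℝ, ψ x (-y) = ψ x y)
    (h0 : ∀ x, ψ x (-1) = 0) (h1 : ∀ x, pdy ψ x (-1) = 0)
    (hinv : ∀ y ∈ Set.Icc (-1 : ℝ) 1, ∀ x₀ x₁, ψ x₀ y = ψ x₁ y)
    (x : ℝ) {y : ℝ} (hy : y ∈ Set.Icc (-1 : ℝ) 1) : ψ x y = 0 := by
  have d1 : ∀ y ∈ Set.Icc (-1 : ℝ) 1, ∀ x, pdx ψ x y = 0 := by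
    intro y hy x
    have : (fun t => ψ t y) = fun _ => ψ 0 y := funext fun t => hinv y hy t 0
    simp [pdx, this]
  have d2 : ∀ y ∈ Set.Icc (-1 : ℝ) 1, ∀ x, pdx (pdx ψ) x y = 0 := fun y hy =>
    pdx_eq_zero_of_horizontal (d1 y hy)
  have d3 : ∀ y ∈ Set.Icc (-1 : ℝ) 1, ∀ x, pdx (pdx (pdx ψ)) x y = 0 := fun y hy =>
    pdx_eq_zero_of_horizontal (d2 y hy)
  have d4 : ∀ y ∈ Set.Icc (-1 : ℝ) 1, ∀ x, pdx (pdx (pdx (pdx ψ))) x y = 0 := fun y hy =>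
    pdx_eq_zero_of_horizontal (d3 y hy)
  have hz : ∀ {f : ℝ → ℝ → ℝ}, (∀ y ∈ Set.Icc (-1 : ℝ) 1, ∀ x, f x y = 0) → ∀ p : ℝ → ℝ,
      ∀ y ∈ Set.Icc (-1 : ℝ) 1, ∫ t in (-1 : ℝ)..y, p t * f x t = 0 := by
    intro f hf p y hy
    rw [integral_congr (g := fun _ => (0 : ℝ)), intervalIntegral.integral_zero]
    intro t ht
    rw [Set.uIcc_of_le hy.1] at ht
    simp [hf t ⟨ht.1, ht.2.trans hy.2⟩ x]
  have hpoly : ∀ y ∈ Set.Icc (-1 : ℝ) 1, ψ x y = pdy (pdy ψ) x (-1) * ((y + 1) ^ 2 / 2)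
      + pdy (pdy (pdy ψ)) x (-1) * ((y + 1) ^ 3 / 6) := by
    intro y hy
    rw [wall_taylor hψ hlin h0 h1 x hy, hz d2 _ y hy, hz d1 _ y hy, hz d4 _ y hy, hz d3 _ y hy]
    ring
  have e1 := hpoly 1 (by norm_num)
  have e2 := hpoly (1 / 2) (by norm_num)
  have e3 := hpoly (-(1 / 2)) (by norm_num)
  rw [← hsymm, h0] at e1
  rw [hsymm, e2] at e3
  have hw : pdy (pdy ψ) x (-1) = 0 := by linarith
  have hc : pdy (pdy (pdy ψ)) x (-1) = 0 := by linarith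
  rw [hpoly y hy, hw, hc]
  ring

/-- Uniformly locally bounded Dirichlet integrals provide one majorant, with bounded unit averages,
of the vertical `L¹` norms of the derivatives. -/
theorem exists_majorant {ψ : ℝ → ℝ → ℝ} (hψ : JointlySmooth ψ) {M : ℝ}
    (hloc : ∀ a : ℝ,
      (∫ x in a..(a + 1), ∫ y in (-1 : ℝ)..1,
          ((pdx ψ x y) ^ 2 + (pdy ψ x y) ^ 2
            + (pdx (pdx ψ) x y) ^ 2 + (pdy (pdx ψ) x y) ^ 2 + (pdy (pdy ψ) x y) ^ 2
            + (pdx (pdx (pdx ψ)) x y) ^ 2 + (pdy (pdx (pdx ψ)) x y) ^ 2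
            + (pdy (pdy (pdx ψ)) x y) ^ 2 + (pdy (pdy (pdy ψ)) x y) ^ 2)) ≤ M) :
    ∃ E : ℝ → ℝ, Continuous E ∧ (∀ x, 0 ≤ E x) ∧
      (∀ a : ℝ, ∫ x in a..(a + 1), E x ≤ 2 + M) ∧
      (∀ x, ∫ t in (-1 : ℝ)..1, |pdx ψ x t| ≤ E x) ∧
      (∀ x, ∫ t in (-1 : ℝ)..1, |pdx (pdx ψ) x t| ≤ E x) ∧
      (∀ x, ∫ t in (-1 : ℝ)..1, |pdx (pdx (pdx ψ)) x t| ≤ E x) ∧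
      (∀ x, ∫ t in (-1 : ℝ)..1, |pdy ψ x t| ≤ E x) ∧
      ∀ x, ∫ t in (-1 : ℝ)..1, |pdy (pdx ψ) x t| ≤ E x := by
  obtain ⟨D, hD⟩ : ∃ D : ℝ → ℝ → ℝ, ∀ x y, D x y = (pdx ψ x y) ^ 2 + (pdy ψ x y) ^ 2
            + (pdx (pdx ψ) x y) ^ 2 + (pdy (pdx ψ) x y) ^ 2 + (pdy (pdy ψ) x y) ^ 2
            + (pdx (pdx (pdx ψ)) x y) ^ 2 + (pdy (pdx (pdx ψ)) x y) ^ 2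
            + (pdy (pdy (pdx ψ)) x y) ^ 2 + (pdy (pdy (pdy ψ)) x y) ^ 2 := ⟨_, fun _ _ => rfl⟩
  have hDs : Continuous (Function.uncurry D) := by
    have hsq : ∀ {f : ℝ → ℝ → ℝ}, JointlySmooth f →
        Continuous fun z : ℝ × ℝ => (f z.1 z.2) ^ 2 := fun hf => (ContDiff.continuous hf).pow 2
    have hDf : Function.uncurry D = fun z : ℝ × ℝ => D z.1 z.2 := rfl
    simp only [hDf, hD]
    have c1 := hsq hψ.pdx
    have c2 := hsq hψ.pdy
    have c3 := hsq hψ.pdx.pdx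
    have c4 := hsq hψ.pdx.pdy
    have c5 := hsq hψ.pdy.pdy
    have c6 := hsq hψ.pdx.pdx.pdx
    have c7 := hsq hψ.pdx.pdx.pdy
    have c8 := hsq hψ.pdx.pdy.pdy
    have c9 := hsq hψ.pdy.pdy.pdy
    exact (((((((c1.add c2).add c3).add c4).add c5).add c6).add c7).add c8).add c9
  have hDx : ∀ x, Continuous (D x) := fun x => hDs.comp (Continuous.prodMk_right x)
  simp only [← hD] at hloc
  have hec : Continuous fun x => ∫ y in (-1 : ℝ)..1, D x y :=
    continuous_parametric_intervalIntegral_of_continuous' hDs _ _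
  have habs : ∀ {f : ℝ → ℝ → ℝ}, JointlySmooth f → (∀ x y, 0 ≤ D x y - (f x y) ^ 2) →
      ∀ x, ∫ t in (-1 : ℝ)..1, |f x t| ≤ 2 + ∫ y in (-1 : ℝ)..1, D x y := by
    intro f hf hfD x
    have h4 : ∫ t in (-1 : ℝ)..1, |f x t| ≤ ∫ t in (-1 : ℝ)..1, (1 + D x t) := by
      refine integral_mono_on (by norm_num) ((hf.continuous_right x).abs.intervalIntegrable _ _)
        ((continuous_const.add (hDx x)).intervalIntegrable _ _) fun t _ => ?_
      nlinarith only [hfD x t, sq_abs (f x t), sq_nonneg (|f x t| - 1), abs_nonneg (f x t)]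
    rw [integral_add (continuous_const.intervalIntegrable _ _)
      ((hDx x).intervalIntegrable _ _)] at h4
    norm_num at h4
    exact h4
  refine ⟨fun x => 2 + ∫ y in (-1 : ℝ)..1, D x y, continuous_const.add hec, fun x => ?_,
    fun a => ?_, habs hψ.pdx fun x y => ?_, habs hψ.pdx.pdx fun x y => ?_,
    habs hψ.pdx.pdx.pdx fun x y => ?_, habs hψ.pdy fun x y => ?_,
    habs hψ.pdx.pdy fun x y => ?_⟩
  · refine add_nonneg zero_le_two (integral_nonneg (by norm_num) fun y _ => ?_)
    rw [hD]
    positivity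
  · rw [integral_add (continuous_const.intervalIntegrable _ _) (hec.intervalIntegrable _ _)]
    simpa using hloc a
  all_goals
    rw [hD]
    ring_nf
    positivity

/-- Uniqueness in the large of the symmetric Couette–Poiseuille flow in the symmetry class
(Y2) (Theorem 6.1 of the paper, stream-function form): under the symmetric condition (AC),
i.e. `(A,C) ≠ (0,0)`, `A ≤ 0`, `C ≥ 3|A|`, with `F(y) = 3Ay² + C`, if `ψ` is smooth,
has uniformly locally bounded Dirichlet integrals (orders 1 to 3), is even in `y`, solves the
full nonlinear stream-function equation
`Δ²ψ − [F(y)(ψ_xyy + ψ_xxx) − 6Aψ_x] + (ψ_x(Δψ)_y − ψ_y(Δψ)_x) = 0` in `S = ℝ × (-1,1)`,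
and `ψ = ψ_x = ψ_y = 0` on `y = ±1`, then `ψ ≡ 0`. -/
theorem stmt_14 (A C : ℝ) (hAC : (A, C) ≠ (0, 0)) (hA : A ≤ 0) (hC : 3 * |A| ≤ C)
    (ψ : ℝ → ℝ → ℝ)
    (hsmooth : ContDiff ℝ (⊤ : ℕ∞) (Function.uncurry ψ))
    (M : ℝ) (hM : 0 < M)
    (hloc : ∀ a : ℝ,
      (∫ x in a..(a + 1), ∫ y in (-1 : ℝ)..1,
          ((pdx ψ x y) ^ 2 + (pdy ψ x y) ^ 2
            + (pdx (pdx ψ) x y) ^ 2 + (pdy (pdx ψ) x y) ^ 2 + (pdy (pdy ψ) x y) ^ 2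
            + (pdx (pdx (pdx ψ)) x y) ^ 2 + (pdy (pdx (pdx ψ)) x y) ^ 2
            + (pdy (pdy (pdx ψ)) x y) ^ 2 + (pdy (pdy (pdy ψ)) x y) ^ 2)) ≤ M)
    (hsymm : ∀ x y : ℝ, ψ x (-y) = ψ x y)
    (heq : ∀ x : ℝ, ∀ y ∈ Set.Ioo (-1 : ℝ) 1,
      pdx (pdx (pdx (pdx ψ))) x y + 2 * pdy (pdy (pdx (pdx ψ))) x y
          + pdy (pdy (pdy (pdy ψ))) x y
        - ((3 * A * y ^ 2 + C) * (pdy (pdy (pdx ψ)) x y + pdx (pdx (pdx ψ)) x y)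
            - 6 * A * pdx ψ x y)
        + (pdx ψ x y * pdy (fun a b => pdx (pdx ψ) a b + pdy (pdy ψ) a b) x y
            - pdy ψ x y * pdx (fun a b => pdx (pdx ψ) a b + pdy (pdy ψ) a b) x y) = 0)
    (hbc : ∀ x : ℝ, ψ x (-1) = 0 ∧ ψ x 1 = 0 ∧ pdx ψ x (-1) = 0 ∧ pdx ψ x 1 = 0 ∧
      pdy ψ x (-1) = 0 ∧ pdy ψ x 1 = 0) :
    ∀ x : ℝ, ∀ y ∈ Set.Icc (-1 : ℝ) 1, ψ x y = 0 := by
  have hψ : JointlySmooth ψ := hsmooth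
  have h0 : ∀ x, ψ x (-1) = 0 := fun x => (hbc x).1
  have h1 : ∀ x, pdy ψ x (-1) = 0 := fun x => (hbc x).2.2.2.2.1
  have hsplit := even_odd_split hsymm heq
  have hlin := fun x y hy => (hsplit x y hy).1
  obtain ⟨h2, h3⟩ := wall_derivatives_constant hψ (fun x y hy => (hsplit x y hy).2) h0 h1
  obtain ⟨E, hEc, hE0, hEM, hE1, hE2, hE3, hEy, hExy⟩ := exists_majorant hψ hloc
  have hB₀ : ∀ x, ∀ y ∈ Set.Icc (-1 : ℝ) 1, |ψ x y| ≤ 2 * (2 + M) := fun x y hy =>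
    abs_le_of_unit_averages (g := fun x => ψ x y) (fun x => hψ.hasDerivAt_left x y)
      (hψ.pdx.continuous_left y) hEc (fun x => hψ.abs_le_of_wall (h0 x) (hEy x) hy)
      (fun x => hψ.pdx.abs_le_of_wall (hbc x).2.2.1 (hExy x) hy) hEM x
  have hE := integrable_mul_inv_one_add_sq hEc hE0 hEM
  intro x y hy
  exact eq_zero_of_translation_invariant hψ hlin hsymm h0 h1
    (fun y hy => eq_of_wall_constant hψ hlin h0 h1 h2 h3 hB₀ hE hE1 hE2 hE3 hy) x hy
end

section
/- There exist real numbers A < 0 and C with C < 3|A|, a real number T > 0, and a C⁴ function φ : [-1,1] → ℂ, not identically zero, such that φ(±1) = φ'(±1) = 0 and φ''''(y) − 2T²φ''(y) + T⁴φ(y) − iT[(3Ay² + C)(φ''(y) − T²φ(y)) − 6Aφ(y)] = 0 for all y ∈ (-1,1). In particular, the linearized operator at the Couette–Poiseuille flow F(y) = 3Ay² + C in the 2π/T-periodic channel is not injective. -/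
section

open Complex
open scoped Nat

/-- The exponential generating function of a sequence. -/
noncomputable def egf (f : ℕ → ℂ) (z : ℂ) : ℂ := ∑' m : ℕ, f m / (m ! : ℂ) * z ^ m

/-- The exponential generating function of `f` converges absolutely everywhere. -/
def EntireEgf (f : ℕ → ℂ) : Prop :=
  ∀ r : ℝ, 0 ≤ r → Summable fun m : ℕ => ‖f m‖ / (m ! : ℝ) * r ^ m

theorem EntireEgf.summable {f : ℕ → ℂ} (hf : EntireEgf f) (z : ℂ) :
    Summable fun m : ℕ => f m / (m ! : ℂ) * z ^ m := by
  refine Summable.of_norm ((hf ‖z‖ (norm_nonneg z)).congr fun m => ?_)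
  simp

theorem EntireEgf.shift {f : ℕ → ℂ} (hf : EntireEgf f) : EntireEgf fun m => f (m + 1) := by
  intro r hr
  have h := (summable_nat_add_iff 1).2 (hf (1 + r) (by linarith))
  refine Summable.of_nonneg_of_le (fun m => by positivity) (fun m => ?_) h
  have hpow : ((m : ℝ) + 1) * r ^ m ≤ (1 + r) ^ (m + 1) := by
    have hmem : 1 ∈ Finset.range (m + 1 + 1) := by simp
    have := Finset.single_le_sum
      (f := fun k => (1 : ℝ) ^ k * r ^ (m + 1 - k) * ((m + 1).choose k : ℝ))
      (fun k _ => by positivity) hmem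
    rw [← add_pow] at this
    simpa [mul_comm] using this
  rw [Nat.factorial_succ]
  push_cast
  have hm : (0 : ℝ) < (m : ℝ) + 1 := by positivity
  have hm' : (0 : ℝ) < (m ! : ℝ) := by positivity
  calc ‖f (m + 1)‖ / (m ! : ℝ) * r ^ m
      = ‖f (m + 1)‖ / (((m : ℝ) + 1) * (m ! : ℝ)) * (((m : ℝ) + 1) * r ^ m) := by
        field_simp
    _ ≤ _ := by gcongr

theorem EntireEgf.hasDerivAt {f : ℕ → ℂ} (hf : EntireEgf f) (z : ℂ) :
    HasDerivAt (egf f) (egf (fun m => f (m + 1)) z) z := by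
  set r : ℝ := ‖z‖ + 1 with hr
  have hr0 : 0 ≤ r := by positivity
  have hz : z ∈ Metric.ball (0 : ℂ) r := by simp [hr]
  have hF : ∀ m : ℕ, DifferentiableOn ℂ (fun z : ℂ => f m / (m ! : ℂ) * z ^ m)
      (Metric.ball 0 r) := fun m => by fun_prop
  have hle : ∀ (m : ℕ) (y : ℂ), y ∈ Metric.ball (0 : ℂ) r →
      ‖f m / (m ! : ℂ) * y ^ m‖ ≤ ‖f m‖ / (m ! : ℝ) * r ^ m := by
    intro m y hy
    have : ‖y‖ ≤ r := by simpa using (mem_ball_zero_iff.1 hy).le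
    simp only [norm_mul, norm_div, norm_pow, Complex.norm_natCast]
    gcongr
  have hdiff := differentiableOn_tsum_of_summable_norm (hf r hr0) hF Metric.isOpen_ball hle
  have hsum := hasSum_deriv_of_summable_norm (hf r hr0) hF Metric.isOpen_ball hle hz
  have hderiv : deriv (egf f) z = egf (fun m => f (m + 1)) z := by
    have h1 : ∀ m : ℕ, deriv (fun z : ℂ => f m / (m ! : ℂ) * z ^ m) z
        = f m / (m ! : ℂ) * (m * z ^ (m - 1)) := by
      intro m
      simp
    simp only [h1] at hsum
    have h2 := hsum.summable.tsum_eq_zero_add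
    rw [hsum.tsum_eq] at h2
    unfold egf
    rw [h2]
    simp only [Nat.cast_zero, zero_mul, mul_zero, zero_add]
    refine tsum_congr fun m => ?_
    have hm : ((m : ℂ) + 1) ≠ 0 := by exact_mod_cast Nat.succ_ne_zero m
    have hm' : (m ! : ℂ) ≠ 0 := by exact_mod_cast Nat.factorial_ne_zero m
    rw [Nat.factorial_succ]
    push_cast
    field_simp
  rw [← hderiv]
  exact (hdiff.differentiableAt (Metric.isOpen_ball.mem_nhds hz)).hasDerivAt

theorem EntireEgf.hasDerivAt_ofReal {f : ℕ → ℂ} (hf : EntireEgf f) (y : ℝ) :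
    HasDerivAt (fun y : ℝ => egf f y) (egf (fun m => f (m + 1)) y) y :=
  (hf.hasDerivAt y).comp_ofReal

theorem EntireEgf.deriv_ofReal {f : ℕ → ℂ} (hf : EntireEgf f) :
    deriv (fun y : ℝ => egf f y) = fun y : ℝ => egf (fun m => f (m + 1)) y :=
  funext fun y => (hf.hasDerivAt_ofReal y).deriv

theorem EntireEgf.contDiff {f : ℕ → ℂ} (hf : EntireEgf f) (n : ℕ) :
    ContDiff ℝ n fun y : ℝ => egf f y := by
  induction n generalizing f with
  | zero =>
    exact contDiff_zero.2 (continuous_iff_continuousAt.2 fun y =>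
      (hf.hasDerivAt_ofReal y).continuousAt)
  | succ n ih =>
    rw [Nat.cast_succ, contDiff_succ_iff_deriv]
    refine ⟨fun y => (hf.hasDerivAt_ofReal y).differentiableAt, by simp, ?_⟩
    rw [hf.deriv_ofReal]
    exact ih hf.shift

theorem EntireEgf.iteratedDeriv_ofReal {f : ℕ → ℂ} (hf : EntireEgf f) (n : ℕ) :
    iteratedDeriv n (fun y : ℝ => egf f y) = fun y : ℝ => egf (fun m => f (m + n)) y := by
  induction n generalizing f with
  | zero => simp
  | succ n ih =>
    rw [iteratedDeriv_succ', hf.deriv_ofReal, ih hf.shift]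
    simp only [Nat.add_assoc]

theorem EntireEgf.hasSum_sq_mul {f : ℕ → ℂ} (hf : EntireEgf f) (z : ℂ) :
    HasSum (fun m : ℕ => (m * (m - 1) * f (m - 2) : ℂ) / (m ! : ℂ) * z ^ m)
      (z ^ 2 * egf f z) := by
  rw [← hasSum_nat_add_iff' 2]
  simp only [Finset.sum_range_succ, Finset.sum_range_zero, Nat.cast_zero, Nat.cast_one, zero_mul,
    sub_self, mul_zero, zero_div, add_zero, sub_zero]
  refine ((hf.summable z).hasSum.mul_left (z ^ 2)).congr_fun ?_
  intro m
  have hm : ((m : ℂ) + 1) ≠ 0 := by exact_mod_cast Nat.succ_ne_zero m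
  have hm2 : ((m : ℂ) + 2) ≠ 0 := by exact_mod_cast Nat.succ_ne_zero (m + 1)
  have hm' : (m ! : ℂ) ≠ 0 := by exact_mod_cast Nat.factorial_ne_zero m
  rw [Nat.factorial_succ, Nat.factorial_succ]
  push_cast
  have : ((m : ℂ) + 1 + 1) ≠ 0 := by rw [add_assoc]; norm_num; exact hm2
  field_simp
  ring

/-- The recurrence satisfied by the even derivatives `u n = φ⁽²ⁿ⁾(0)` of a solution of
`φ'''' - 2φ'' + φ - i ((b - R y²)(φ'' - φ) + 2 R φ) = 0`, with `v` the differences of `u`,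
`p` the previous values of `v`, and a forcing term `F`. -/
structure IsOSRec (R b : ℝ) (F u v p : ℕ → ℂ) : Prop where
  u_succ : ∀ n, u (n + 1) = u n + v n
  v_succ : ∀ n, v (n + 1) = (1 + I * b) * v n
    + I * R * (2 * u n - 2 * n * (2 * n - 1) * p n) + F n
  p_zero : p 0 = 0
  p_succ : ∀ n, p (n + 1) = v n

/-- The triples `(u n, v n, p n)` of `IsOSRec` with prescribed `u 0` and `v 0`. -/
noncomputable def osRec (R b : ℝ) (F : ℕ → ℂ) (u₀ v₀ : ℂ) : ℕ → ℂ × ℂ × ℂ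
  | 0 => (u₀, v₀, 0)
  | n + 1 =>
    let s := osRec R b F u₀ v₀ n
    (s.1 + s.2.1, (1 + I * b) * s.2.1 + I * R * (2 * s.1 - 2 * n * (2 * n - 1) * s.2.2) + F n,
      s.2.1)

theorem isOSRec_osRec (R b : ℝ) (F : ℕ → ℂ) (u₀ v₀ : ℂ) :
    IsOSRec R b F (fun n => (osRec R b F u₀ v₀ n).1) (fun n => (osRec R b F u₀ v₀ n).2.1)
      (fun n => (osRec R b F u₀ v₀ n).2.2) :=
  ⟨fun _ => rfl, fun _ => rfl, rfl, fun _ => rfl⟩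

/-- A sequence dominating the solutions of the recurrence `IsOSRec` near the critical parameters. -/
def majorant : ℕ → ℕ
  | 0 => 1
  | n + 1 => 180 * (n + 32) * majorant n

theorem majorant_succ (n : ℕ) :
    (majorant (n + 1) : ℝ) = 180 * ((n : ℝ) + 32) * majorant n := by
  simp [majorant]

/-- `(u, v, p)` is dominated by `K` times the majorant. -/
structure OSBound (K : ℝ) (u v p : ℕ → ℂ) : Prop where
  u_le : ∀ n, ‖u n‖ ≤ K * majorant n
  v_le : ∀ n, ‖v n‖ ≤ 4000 * K * majorant n
  p_le : ∀ n : ℕ, 180 * ((n : ℝ) + 31) * ‖p n‖ ≤ 4000 * K * majorant n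

theorem norm_recurrence_index (n : ℕ) :
    ‖(2 * n * (2 * n - 1) : ℂ)‖ = 2 * n * (2 * n - 1) := by
  have h : (0 : ℝ) ≤ 2 * n * (2 * n - 1) := by
    rcases Nat.eq_zero_or_pos n with rfl | hn
    · simp
    · have : (1 : ℝ) ≤ n := by exact_mod_cast hn
      nlinarith
  have : (2 * n * (2 * n - 1) : ℂ) = ((2 * n * (2 * n - 1) : ℝ) : ℂ) := by push_cast; ring
  rw [this, Complex.norm_real, Real.norm_of_nonneg h]

theorem index_mul_le {n : ℕ} {x q : ℝ} (hq : 0 ≤ q)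
    (h : 180 * ((n : ℝ) + 31) * q ≤ x) :
    2 * n * (2 * n - 1) * q ≤ n / 45 * x := by
  have hn : (0 : ℝ) ≤ n := n.cast_nonneg
  have h1 : 2 * n * (2 * n - 1) * q ≤ 4 * n * (n * q) := by nlinarith [mul_nonneg hn hq]
  have h2 : n * q ≤ x / 180 := by nlinarith
  nlinarith

theorem norm_coupling_le {n : ℕ} {K : ℝ} {u p : ℂ} (hu : ‖u‖ ≤ K * majorant n)
    (hp : 180 * ((n : ℝ) + 31) * ‖p‖ ≤ 4000 * K * majorant n) :
    ‖2 * u - 2 * n * (2 * n - 1) * p‖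
      ≤ 2 * (K * majorant n) + n / 45 * (4000 * K * majorant n) := by
  refine (norm_sub_le _ _).trans (add_le_add ?_ ?_)
  · rw [norm_mul]; simpa using hu
  · rw [norm_mul, norm_recurrence_index]
    exact index_mul_le (norm_nonneg _) hp

theorem IsOSRec.osBound {R b K : ℝ} {F u v p : ℕ → ℂ} (h : IsOSRec R b F u v p) (hK : 0 ≤ K)
    (hR : |R| ≤ 5816) (hb : |b| ≤ 4298) (hu : ‖u 0‖ ≤ K) (hv : ‖v 0‖ ≤ 4000 * K)
    (hF : ∀ n, ‖F n‖ ≤ 1000 * K * majorant (n + 1)) : OSBound K u v p := by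
  have key : ∀ n : ℕ, ‖u n‖ ≤ K * majorant n ∧ ‖v n‖ ≤ 4000 * K * majorant n ∧
      180 * ((n : ℝ) + 31) * ‖p n‖ ≤ 4000 * K * majorant n := by
    intro n
    induction n with
    | zero => exact ⟨by simpa [majorant] using hu, by simpa [majorant] using hv, by
        simp only [h.p_zero, norm_zero, mul_zero]; positivity⟩
    | succ n ih =>
      obtain ⟨ihu, ihv, ihp⟩ := ih
      have hKx : 0 ≤ K * majorant n := by positivity
      have hn : (0 : ℝ) ≤ n := n.cast_nonneg
      refine ⟨?_, ?_, ?_⟩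
      · rw [h.u_succ, majorant_succ]
        refine (norm_add_le _ _).trans ?_
        nlinarith [mul_nonneg hn hKx]
      · have h1 : ‖(1 + I * b) * v n‖ ≤ 4299 * (4000 * K * majorant n) := by
          rw [norm_mul]
          have : ‖(1 + I * b : ℂ)‖ ≤ 4299 := by
            refine (norm_add_le _ _).trans ?_
            simp only [norm_one, norm_mul, norm_I, one_mul, Complex.norm_real, Real.norm_eq_abs]
            linarith
          gcongr
        have h2 := norm_coupling_le ihu ihp
        have h3 : ‖I * R * (2 * u n - 2 * n * (2 * n - 1) * p n)‖
            ≤ 5816 * (2 * (K * majorant n) + n / 45 * (4000 * K * majorant n)) := by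
          rw [norm_mul, norm_mul, norm_I, one_mul, Complex.norm_real, Real.norm_eq_abs]
          gcongr
        have h4 := hF n
        rw [h.v_succ]
        refine (norm_add₃_le).trans ?_
        rw [majorant_succ] at h4 ⊢
        nlinarith [mul_nonneg hn hKx]
      · rw [h.p_succ, majorant_succ]
        push_cast
        nlinarith [mul_le_mul_of_nonneg_left ihv (by positivity : (0 : ℝ) ≤ 180 * ((n : ℝ) + 32))]
  exact ⟨fun n => (key n).1, fun n => (key n).2.1, fun n => (key n).2.2⟩

theorem OSBound.perturbation_le {K δ ρ β : ℝ} {u v p : ℕ → ℂ} (h : OSBound K u v p) (hK : 0 ≤ K)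
    (hρ : |ρ| ≤ δ) (hβ : |β| ≤ δ) (n : ℕ) :
    ‖I * β * v n + I * ρ * (2 * u n - 2 * n * (2 * n - 1) * p n)‖
      ≤ 500 * (δ * K) * majorant (n + 1) := by
  have hδ : 0 ≤ δ := (abs_nonneg _).trans hρ
  have hn : (0 : ℝ) ≤ n := n.cast_nonneg
  have h1 : ‖I * β * v n‖ ≤ δ * (4000 * K * majorant n) := by
    rw [norm_mul, norm_mul, norm_I, one_mul, Complex.norm_real, Real.norm_eq_abs]
    have := h.v_le n
    gcongr
  have h2 := norm_coupling_le (h.u_le n) (h.p_le n)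
  have h3 : ‖I * ρ * (2 * u n - 2 * n * (2 * n - 1) * p n)‖
      ≤ δ * (2 * (K * majorant n) + n / 45 * (4000 * K * majorant n)) := by
    rw [norm_mul, norm_mul, norm_I, one_mul, Complex.norm_real, Real.norm_eq_abs]
    gcongr
  refine (norm_add_le _ _).trans ?_
  rw [majorant_succ]
  have : 0 ≤ δ * K * majorant n := by positivity
  nlinarith [mul_nonneg hn this]

/-- The majorant of the terms of the series for `φ(1)` and `φ'(1)`. -/
noncomputable def majTerm (n : ℕ) : ℝ := (2 * n + 1) / ((2 * n)! : ℝ) * majorant n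

theorem majTerm_nonneg (n : ℕ) : 0 ≤ majTerm n := by
  unfold majTerm; positivity

theorem majTerm_succ (n : ℕ) : majTerm (n + 1) =
    180 * (n + 32) * (2 * n + 3) / ((2 * n + 1) ^ 2 * (2 * n + 2)) * majTerm n := by
  unfold majTerm
  rw [majorant_succ, show 2 * (n + 1) = 2 * n + 1 + 1 by ring, Nat.factorial_succ,
    Nat.factorial_succ]
  push_cast
  field_simp
  ring

theorem majTerm_succ_le {n : ℕ} (hn : 120 ≤ n) : majTerm (n + 1) ≤ 1 / 2 * majTerm n := by
  rw [majTerm_succ]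
  refine mul_le_mul_of_nonneg_right ?_ (majTerm_nonneg n)
  have hn' : (120 : ℝ) ≤ n := by exact_mod_cast hn
  rw [div_le_div_iff₀ (by positivity) (by norm_num)]
  nlinarith [mul_nonneg (sub_nonneg.2 hn') (sub_nonneg.2 hn'),
    mul_nonneg (mul_nonneg (sub_nonneg.2 hn') (sub_nonneg.2 hn')) (sub_nonneg.2 hn')]

theorem majTerm_add_le {N : ℕ} (hN : 120 ≤ N) (n : ℕ) :
    majTerm (n + N) ≤ majTerm N * (1 / 2) ^ n := by
  induction n with
  | zero => simp
  | succ n ih =>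
    rw [show n + 1 + N = n + N + 1 by ring, pow_succ]
    linarith [majTerm_succ_le (show 120 ≤ n + N by omega)]

theorem summable_majTerm_add {N : ℕ} (hN : 120 ≤ N) : Summable fun n => majTerm (n + N) :=
  Summable.of_nonneg_of_le (fun _ => majTerm_nonneg _) (majTerm_add_le hN)
    (summable_geometric_two.mul_left _)

theorem summable_majTerm : Summable majTerm :=
  (summable_nat_add_iff 120).1 (summable_majTerm_add le_rfl)

theorem tsum_majTerm_add_le {N : ℕ} (hN : 120 ≤ N) :
    ∑' n, majTerm (n + N) ≤ 2 * majTerm N := by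
  refine ((summable_majTerm_add hN).tsum_le_tsum (majTerm_add_le hN)
    (summable_geometric_two.mul_left _)).trans ?_
  rw [tsum_mul_left, tsum_geometric_two, mul_comm]

theorem majTerm_le_of_le {n c d : ℕ} (hd : 0 < d)
    (h : (2 * n + 1) * majorant n * d ≤ c * (2 * n)!) : majTerm n ≤ c / d := by
  unfold majTerm
  rw [div_mul_eq_mul_div, div_le_div_iff₀ (by positivity) (by exact_mod_cast hd)]
  exact_mod_cast h

theorem majorant_le_of_lt_121 :
    ∀ n < 121, (2 * n + 1) * majorant n * 1 ≤ 10 ^ 45 * (2 * n)! := by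
  decide +kernel

theorem majorant_401_le :
    (2 * 401 + 1) * majorant 401 * 10 ^ 150 ≤ 1 * (2 * 401)! := by
  decide +kernel

theorem tsum_majTerm_le : ∑' n, majTerm n ≤ 10 ^ 48 := by
  have h : ∀ n < 121, majTerm n ≤ 10 ^ 45 := fun n hn =>
    (majTerm_le_of_le one_pos (majorant_le_of_lt_121 n hn)).trans_eq (by norm_num)
  rw [← summable_majTerm.sum_add_tsum_nat_add 120]
  have h1 : ∑ n ∈ Finset.range 120, majTerm n ≤ ∑ _n ∈ Finset.range 120, (10 : ℝ) ^ 45 :=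
    Finset.sum_le_sum fun n hn => h n (by have := Finset.mem_range.1 hn; omega)
  have h2 := tsum_majTerm_add_le le_rfl
  have h3 := h 120 (by norm_num)
  simp only [Finset.sum_const, Finset.card_range, nsmul_eq_mul] at h1
  push_cast at h1
  linarith

theorem tsum_majTerm_tail_le : ∑' n, majTerm (n + 401) ≤ 2 / 10 ^ 150 := by
  have h1 := tsum_majTerm_add_le (N := 401) (by norm_num)
  have h2 := majTerm_le_of_le (by positivity) majorant_401_le
  push_cast at h2
  linarith

/-- The weights through which `φ(1)` and `φ'(1)` depend on the Taylor coefficients. -/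
def IsEndpointWeight (c : ℕ → ℂ) : Prop :=
  ∀ n : ℕ, ‖c n‖ ≤ (2 * n + 1) / ((2 * n)! : ℝ)

theorem IsEndpointWeight.norm_mul_le {c u : ℕ → ℂ} {K : ℝ} (hc : IsEndpointWeight c)
    (hu : ∀ n, ‖u n‖ ≤ K * majorant n) (n : ℕ) : ‖c n * u n‖ ≤ K * majTerm n := by
  rw [norm_mul, majTerm]
  calc ‖c n‖ * ‖u n‖ ≤ (2 * n + 1) / ((2 * n)! : ℝ) * (K * majorant n) :=
        mul_le_mul (hc n) (hu n) (norm_nonneg _) (by positivity)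
    _ = _ := by ring

theorem IsEndpointWeight.summable {c u : ℕ → ℂ} {K : ℝ} (hc : IsEndpointWeight c)
    (hu : ∀ n, ‖u n‖ ≤ K * majorant n) : Summable fun n => c n * u n :=
  Summable.of_norm_bounded (summable_majTerm.mul_left K) (hc.norm_mul_le hu)

theorem IsEndpointWeight.norm_tsum_le {c u : ℕ → ℂ} {K : ℝ} (hc : IsEndpointWeight c)
    (hK : 0 ≤ K) (hu : ∀ n, ‖u n‖ ≤ K * majorant n) : ‖∑' n, c n * u n‖ ≤ 10 ^ 48 * K := by
  refine (tsum_of_norm_bounded (summable_majTerm.mul_left K).hasSum (hc.norm_mul_le hu)).trans ?_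
  rw [tsum_mul_left, mul_comm]
  exact mul_le_mul_of_nonneg_right tsum_majTerm_le hK

theorem IsEndpointWeight.norm_tsum_sub_sum_le {c u : ℕ → ℂ} {K : ℝ} (hc : IsEndpointWeight c)
    (hK : 0 ≤ K) (hu : ∀ n, ‖u n‖ ≤ K * majorant n) :
    ‖∑' n, c n * u n - ∑ n ∈ Finset.range 401, c n * u n‖ ≤ 2 / 10 ^ 150 * K := by
  rw [← (hc.summable hu).sum_add_tsum_nat_add 401, add_sub_cancel_left]
  refine (tsum_of_norm_bounded ((summable_majTerm_add (N := 401) (by norm_num)).mul_left K).hasSum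
    fun n => hc.norm_mul_le hu (n + 401)).trans ?_
  rw [tsum_mul_left, mul_comm]
  exact mul_le_mul_of_nonneg_right tsum_majTerm_tail_le hK

/-- The coefficients of `φ(1)` in terms of the Taylor coefficients. -/
noncomputable def valueWeight (n : ℕ) : ℂ := 1 / ((2 * n)! : ℂ)

/-- The coefficients of `φ'(1)` in terms of the Taylor coefficients. -/
noncomputable def slopeWeight (n : ℕ) : ℂ := (2 * n : ℂ) / ((2 * n)! : ℂ)

theorem isEndpointWeight_value : IsEndpointWeight valueWeight := by
  intro n
  rw [valueWeight, norm_div, norm_one, Complex.norm_natCast]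
  gcongr
  have : (0 : ℝ) ≤ n := n.cast_nonneg
  linarith

theorem isEndpointWeight_slope : IsEndpointWeight slopeWeight := by
  intro n
  rw [slopeWeight, norm_div, norm_mul, Complex.norm_natCast, Complex.norm_natCast,
    Complex.norm_ofNat]
  gcongr
  linarith

/-- On the square of radius `r` around `(R₀, b₀)`, the function `f` is bounded by `M`, is
`M`-Lipschitz, and differs from a linear map with coefficients `fR`, `fb` by an `M r`-Lipschitz
function. -/
structure NearlyAffine (R₀ b₀ r M : ℝ) (f : ℝ → ℝ → ℂ) (fR fb : ℂ) : Prop where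
  norm_le : ∀ R b, |R - R₀| ≤ r → |b - b₀| ≤ r → ‖f R b‖ ≤ M
  lipschitz : ∀ R b R' b' δ, |R - R₀| ≤ r → |b - b₀| ≤ r → |R' - R₀| ≤ r → |b' - b₀| ≤ r →
    |R - R'| ≤ δ → |b - b'| ≤ δ → ‖f R b - f R' b'‖ ≤ M * δ
  affine : ∀ R b R' b' δ, |R - R₀| ≤ r → |b - b₀| ≤ r → |R' - R₀| ≤ r → |b' - b₀| ≤ r →
    |R - R'| ≤ δ → |b - b'| ≤ δ →
    ‖f R b - f R' b' - ((R - R' : ℝ) * fR + (b - b' : ℝ) * fb)‖ ≤ M * (r * δ)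

theorem NearlyAffine.mul_sub_mul {R₀ b₀ r M : ℝ} {f g h k : ℝ → ℝ → ℂ}
    {fR fb gR gb hR hb kR kb : ℂ} (hr : 0 ≤ r) (hr1 : r ≤ 1) (hM : 0 ≤ M)
    (hf : NearlyAffine R₀ b₀ r M f fR fb) (hg : NearlyAffine R₀ b₀ r M g gR gb)
    (hh : NearlyAffine R₀ b₀ r M h hR hb) (hk : NearlyAffine R₀ b₀ r M k kR kb) :
    NearlyAffine R₀ b₀ r (12 * M ^ 2) (fun R b => f R b * k R b - g R b * h R b)
      (f R₀ b₀ * kR + k R₀ b₀ * fR - (g R₀ b₀ * hR + h R₀ b₀ * gR))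
      (f R₀ b₀ * kb + k R₀ b₀ * fb - (g R₀ b₀ * hb + h R₀ b₀ * gb)) := by
  have h0 : |R₀ - R₀| ≤ r := by simpa using hr
  have h0' : |b₀ - b₀| ≤ r := by simpa using hr
  have lin : ∀ {f : ℝ → ℝ → ℂ} {fR fb : ℂ}, NearlyAffine R₀ b₀ r M f fR fb →
      ∀ R b R' b' δ, |R - R₀| ≤ r → |b - b₀| ≤ r → |R' - R₀| ≤ r → |b' - b₀| ≤ r →
      |R - R'| ≤ δ → |b - b'| ≤ δ →
      ‖((R - R' : ℝ) : ℂ) * fR + (b - b' : ℝ) * fb‖ ≤ 2 * M * δ := by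
    intro f fR fb hf R b R' b' δ h1 h2 h3 h4 h5 h6
    have hδ : 0 ≤ δ := (abs_nonneg _).trans h5
    have e1 := hf.lipschitz R b R' b' δ h1 h2 h3 h4 h5 h6
    have e2 := hf.affine R b R' b' δ h1 h2 h3 h4 h5 h6
    have e3 := norm_sub_norm_le (((R - R' : ℝ) : ℂ) * fR + (b - b' : ℝ) * fb) (f R b - f R' b')
    rw [norm_sub_rev (((R - R' : ℝ) : ℂ) * fR + (b - b' : ℝ) * fb)] at e3
    have e4 : M * (r * δ) ≤ M * δ := by
      gcongr; nlinarith
    linarith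
  have prod : ∀ {f k : ℝ → ℝ → ℂ} {fR fb kR kb : ℂ}, NearlyAffine R₀ b₀ r M f fR fb →
      NearlyAffine R₀ b₀ r M k kR kb →
      ∀ R b R' b' δ, |R - R₀| ≤ r → |b - b₀| ≤ r → |R' - R₀| ≤ r → |b' - b₀| ≤ r →
      |R - R'| ≤ δ → |b - b'| ≤ δ →
      ‖f R b * k R b - f R' b' * k R' b'‖ ≤ 2 * M ^ 2 * δ ∧
      ‖f R b * k R b - f R' b' * k R' b' - ((R - R' : ℝ) * (f R₀ b₀ * kR + k R₀ b₀ * fR)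
        + (b - b' : ℝ) * (f R₀ b₀ * kb + k R₀ b₀ * fb))‖ ≤ 6 * M ^ 2 * (r * δ) := by
    intro f k fR fb kR kb hf hk R b R' b' δ h1 h2 h3 h4 h5 h6
    have hδ : 0 ≤ δ := (abs_nonneg _).trans h5
    have f1 := hf.norm_le R b h1 h2
    have k1 := hk.norm_le R' b' h3 h4
    have f2 := hf.lipschitz R b R' b' δ h1 h2 h3 h4 h5 h6
    have k2 := hk.lipschitz R b R' b' δ h1 h2 h3 h4 h5 h6
    have f3 := hf.affine R b R' b' δ h1 h2 h3 h4 h5 h6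
    have k3 := hk.affine R b R' b' δ h1 h2 h3 h4 h5 h6
    have f4 := hf.lipschitz R b R₀ b₀ r h1 h2 h0 h0' h1 h2
    have k4 := hk.lipschitz R' b' R₀ b₀ r h3 h4 h0 h0' h3 h4
    have f5 := lin hf R b R' b' δ h1 h2 h3 h4 h5 h6
    have k5 := lin hk R b R' b' δ h1 h2 h3 h4 h5 h6
    constructor
    · rw [show f R b * k R b - f R' b' * k R' b'
        = f R b * (k R b - k R' b') + k R' b' * (f R b - f R' b') by ring]
      refine (norm_add_le _ _).trans ?_
      rw [norm_mul, norm_mul]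
      nlinarith [mul_le_mul f1 k2 (norm_nonneg _) hM, mul_le_mul k1 f2 (norm_nonneg _) hM]
    · set F := ((R - R' : ℝ) : ℂ) * fR + (b - b' : ℝ) * fb with hF
      set G := ((R - R' : ℝ) : ℂ) * kR + (b - b' : ℝ) * kb with hG
      rw [show f R b * k R b - f R' b' * k R' b'
          - (((R - R' : ℝ) : ℂ) * (f R₀ b₀ * kR + k R₀ b₀ * fR)
            + (b - b' : ℝ) * (f R₀ b₀ * kb + k R₀ b₀ * fb))
        = (f R b * (k R b - k R' b' - G) + (f R b - f R₀ b₀) * G)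
          + (k R' b' * (f R b - f R' b' - F) + (k R' b' - k R₀ b₀) * F) by
        rw [hF, hG]; ring]
      refine (norm_add_le _ _).trans ((add_le_add (norm_add_le _ _) (norm_add_le _ _)).trans ?_)
      simp only [norm_mul]
      have m1 := mul_le_mul f1 k3 (norm_nonneg _) hM
      have m2 := mul_le_mul f4 k5 (norm_nonneg _) (by positivity)
      have m3 := mul_le_mul k1 f3 (norm_nonneg _) hM
      have m4 := mul_le_mul k4 f5 (norm_nonneg _) (by positivity)
      nlinarith
  refine ⟨fun R b h1 h2 => ?_, fun R b R' b' δ h1 h2 h3 h4 h5 h6 => ?_,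
    fun R b R' b' δ h1 h2 h3 h4 h5 h6 => ?_⟩
  · refine (norm_sub_le _ _).trans ?_
    rw [norm_mul, norm_mul]
    nlinarith [mul_le_mul (hf.norm_le R b h1 h2) (hk.norm_le R b h1 h2) (norm_nonneg _) hM,
      mul_le_mul (hg.norm_le R b h1 h2) (hh.norm_le R b h1 h2) (norm_nonneg _) hM]
  · have hδ : 0 ≤ δ := (abs_nonneg _).trans h5
    have e1 := (prod hf hk R b R' b' δ h1 h2 h3 h4 h5 h6).1
    have e2 := (prod hg hh R b R' b' δ h1 h2 h3 h4 h5 h6).1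
    rw [show f R b * k R b - g R b * h R b - (f R' b' * k R' b' - g R' b' * h R' b')
      = (f R b * k R b - f R' b' * k R' b') - (g R b * h R b - g R' b' * h R' b') by ring]
    refine (norm_sub_le _ _).trans ?_
    nlinarith [mul_nonneg (sq_nonneg M) hδ]
  · have e1 := (prod hf hk R b R' b' δ h1 h2 h3 h4 h5 h6).2
    have e2 := (prod hg hh R b R' b' δ h1 h2 h3 h4 h5 h6).2
    refine (le_of_eq_of_le (congrArg _ ?_) (norm_sub_le _ _)).trans
      ((add_le_add e1 e2).trans (le_of_eq (by ring)))
    ring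

/-- A function that is nearly affine, nearly vanishes at the centre, and has nearly the linear part
`(s, t) ↦ s jR + t jb`, has a zero. -/
theorem NearlyAffine.exists_zero {R₀ b₀ r M κ ε : ℝ} {f : ℝ → ℝ → ℂ} {fR fb jR jb : ℂ}
    (hf : NearlyAffine R₀ b₀ r M f fR fb) (hr : 0 < r) (hε : 0 ≤ ε)
    (h₀ : ‖f R₀ b₀‖ ≤ ε * r) (hR : ‖f (R₀ + r) b₀ - r * jR‖ ≤ ε * r)
    (hb : ‖f R₀ (b₀ + r) - r * jb‖ ≤ ε * r)
    (hdet : jR.re * jb.im - jR.im * jb.re ≠ 0)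
    (hjR : |jR.re| + |jR.im| ≤ κ * |jR.re * jb.im - jR.im * jb.re|)
    (hjb : |jb.re| + |jb.im| ≤ κ * |jR.re * jb.im - jR.im * jb.re|)
    (hκ : 2 * κ * ε ≤ 1) (hκ' : 2 * κ * (3 * (M * r) + 4 * ε) ≤ 1) :
    ∃ R b, |R - R₀| ≤ r ∧ |b - b₀| ≤ r ∧ f R b = 0 := by
  set d : ℝ := jR.re * jb.im - jR.im * jb.re with hd
  have hκ0 : 0 ≤ κ := by
    by_contra hneg
    have := mul_neg_of_neg_of_pos (not_le.1 hneg) (abs_pos.2 hdet)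
    linarith [abs_nonneg jR.re, abs_nonneg jR.im]
  have hz0 : |R₀ - R₀| ≤ r := by simpa using hr.le
  have hz0' : |b₀ - b₀| ≤ r := by simpa using hr.le
  have hz1 : |R₀ + r - R₀| ≤ r := by rw [add_sub_cancel_left, abs_of_pos hr]
  have hz1' : |b₀ + r - b₀| ≤ r := by rw [add_sub_cancel_left, abs_of_pos hr]
  have hfR : ‖fR - jR‖ ≤ M * r + 2 * ε := by
    have e := hf.affine (R₀ + r) b₀ R₀ b₀ r hz1 hz0' hz0 hz0' hz1 hz0'
    have : (r : ℂ) * (fR - jR) = (f (R₀ + r) b₀ - r * jR) - f R₀ b₀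
        - (f (R₀ + r) b₀ - f R₀ b₀
          - (((R₀ + r - R₀ : ℝ) : ℂ) * fR + ((b₀ - b₀ : ℝ) : ℂ) * fb)) := by
      push_cast; ring
    have h := congrArg norm this
    rw [norm_mul, Complex.norm_real, Real.norm_of_nonneg hr.le] at h
    have h' := h.le.trans ((norm_sub_le _ _).trans (add_le_add (norm_sub_le _ _) le_rfl))
    refine le_of_mul_le_mul_left ?_ hr
    linarith
  have hfb : ‖fb - jb‖ ≤ M * r + 2 * ε := by
    have e := hf.affine R₀ (b₀ + r) R₀ b₀ r hz0 hz1' hz0 hz0' hz0 hz1'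
    have : (r : ℂ) * (fb - jb) = (f R₀ (b₀ + r) - r * jb) - f R₀ b₀
        - (f R₀ (b₀ + r) - f R₀ b₀
          - (((R₀ - R₀ : ℝ) : ℂ) * fR + ((b₀ + r - b₀ : ℝ) : ℂ) * fb)) := by
      push_cast; ring
    have h := congrArg norm this
    rw [norm_mul, Complex.norm_real, Real.norm_of_nonneg hr.le] at h
    have h' := h.le.trans ((norm_sub_le _ _).trans (add_le_add (norm_sub_le _ _) le_rfl))
    refine le_of_mul_le_mul_left ?_ hr
    linarith
  -- the inverse of `(s, t) ↦ s jR + t jb`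
  let s : ℂ → ℝ := fun z => (z.re * jb.im - z.im * jb.re) / d
  let t : ℂ → ℝ := fun z => (z.im * jR.re - z.re * jR.im) / d
  have hs_sub : ∀ z z', s z - s z' = s (z - z') := fun z z' => by
    simp only [s, Complex.sub_re, Complex.sub_im]; ring
  have ht_sub : ∀ z z', t z - t z' = t (z - z') := fun z z' => by
    simp only [t, Complex.sub_re, Complex.sub_im]; ring
  have hst : ∀ z, (s z : ℂ) * jR + (t z : ℂ) * jb = z := by
    intro z
    apply Complex.ext
    · simp only [s, t, Complex.add_re, Complex.re_ofReal_mul]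
      field_simp
      rw [hd]; ring
    · simp only [s, t, Complex.add_im, Complex.im_ofReal_mul]
      field_simp
      rw [hd]; ring
  have hbd : ∀ (x y : ℝ) (z : ℂ), |x| + |y| ≤ κ * |d| → |(z.re * y - z.im * x) / d| ≤ κ * ‖z‖ := by
    intro x y z hxy
    rw [abs_div, div_le_iff₀ (abs_pos.2 hdet)]
    have h1 : |z.re * y - z.im * x| ≤ |z.re| * |y| + |z.im| * |x| := by
      rw [← abs_mul, ← abs_mul]; exact abs_sub _ _
    have h2 := mul_le_mul_of_nonneg_right (Complex.abs_re_le_norm z) (abs_nonneg y)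
    have h3 := mul_le_mul_of_nonneg_right (Complex.abs_im_le_norm z) (abs_nonneg x)
    nlinarith [mul_le_mul_of_nonneg_left hxy (norm_nonneg z)]
  have hs_le : ∀ z, |s z| ≤ κ * ‖z‖ := fun z => hbd _ _ z hjb
  have ht_le : ∀ z, |t z| ≤ κ * ‖z‖ := fun z => by
    rw [← abs_neg, show -t z = (z.re * jR.im - z.im * jR.re) / d by simp only [t]; ring]
    exact hbd _ _ z hjR
  set ρ : ℝ := 2 * ε * r with hρ
  have hmem : ∀ z ∈ Metric.closedBall (0 : ℂ) ρ, |R₀ + s z - R₀| ≤ r ∧ |b₀ + t z - b₀| ≤ r := by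
    intro z hz
    have hz' : ‖z‖ ≤ ρ := mem_closedBall_zero_iff.1 hz
    have : κ * ‖z‖ ≤ r := by
      have := mul_le_mul_of_nonneg_left hz' hκ0
      nlinarith
    rw [add_sub_cancel_left, add_sub_cancel_left]
    exact ⟨(hs_le z).trans this, (ht_le z).trans this⟩
  let G : ℂ → ℂ := fun z => z - f (R₀ + s z) (b₀ + t z)
  have hG : ∀ z ∈ Metric.closedBall (0 : ℂ) ρ, ∀ z' ∈ Metric.closedBall (0 : ℂ) ρ,
      ‖G z - G z'‖ ≤ 1 / 2 * ‖z - z'‖ := by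
    intro z hz z' hz'
    have es : R₀ + s z - (R₀ + s z') = s (z - z') := by rw [← hs_sub]; ring
    have et : b₀ + t z - (b₀ + t z') = t (z - z') := by rw [← ht_sub]; ring
    have e := hf.affine (R₀ + s z) (b₀ + t z) (R₀ + s z') (b₀ + t z') (κ * ‖z - z'‖)
      (hmem z hz).1 (hmem z hz).2 (hmem z' hz').1 (hmem z' hz').2
      (by rw [es]; exact hs_le _) (by rw [et]; exact ht_le _)
    rw [es, et] at e
    have : G z - G z' = -(f (R₀ + s z) (b₀ + t z) - f (R₀ + s z') (b₀ + t z')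
          - ((s (z - z') : ℂ) * fR + (t (z - z') : ℂ) * fb))
        - ((s (z - z') : ℂ) * (fR - jR) + (t (z - z') : ℂ) * (fb - jb)) := by
      have := hst (z - z')
      simp only [G]
      linear_combination -this
    rw [this]
    refine (norm_sub_le _ _).trans ((add_le_add le_rfl (norm_add_le _ _)).trans ?_)
    rw [norm_neg, norm_mul, norm_mul, Complex.norm_real, Complex.norm_real, Real.norm_eq_abs,
      Real.norm_eq_abs]
    have e1 := mul_le_mul (hs_le (z - z')) hfR (norm_nonneg _) (by positivity)
    have e2 := mul_le_mul (ht_le (z - z')) hfb (norm_nonneg _) (by positivity)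
    have e3 := mul_le_mul_of_nonneg_right hκ' (norm_nonneg (z - z'))
    nlinarith
  have hG0 : ‖G 0‖ ≤ ρ / 2 := by
    simp only [G, s, t, Complex.zero_re, Complex.zero_im, zero_mul, sub_zero, zero_div, add_zero,
      zero_sub, norm_neg]
    rw [hρ]; linarith
  have h0mem : (0 : ℂ) ∈ Metric.closedBall (0 : ℂ) ρ := by
    simp only [Metric.mem_closedBall, _root_.dist_self]; positivity
  have hmaps : Set.MapsTo G (Metric.closedBall 0 ρ) (Metric.closedBall 0 ρ) := by
    intro z hz
    have h1 := hG z hz 0 h0mem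
    have h2 : ‖z‖ ≤ ρ := mem_closedBall_zero_iff.1 hz
    rw [mem_closedBall_zero_iff]
    have h3 := norm_sub_norm_le (G z) (G 0)
    rw [sub_zero] at h1
    linarith
  have hcontr : ContractingWith (1 / 2) (hmaps.restrict G _ _) := by
    refine ⟨by rw [div_lt_iff₀ (by norm_num)]; norm_num, LipschitzWith.of_dist_le_mul ?_⟩
    rintro ⟨z, hz⟩ ⟨z', hz'⟩
    simp only [Subtype.dist_eq, Set.MapsTo.val_restrict_apply, dist_eq_norm]
    simpa using hG z hz z' hz'
  obtain ⟨z, hz, hfix, -⟩ := hcontr.exists_fixedPoint' Metric.isClosed_closedBall.isComplete hmaps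
    h0mem (edist_ne_top _ _)
  exact ⟨R₀ + s z, b₀ + t z, (hmem z hz).1, (hmem z hz).2, sub_eq_self.1 hfix⟩

theorem IsOSRec.sub {R b R' b' : ℝ} {F u v p F' u' v' p' : ℕ → ℂ} (h : IsOSRec R b F u v p)
    (h' : IsOSRec R' b' F' u' v' p') :
    IsOSRec R b (fun n => F n - F' n + (I * (b - b' : ℝ) * v' n
        + I * (R - R' : ℝ) * (2 * u' n - 2 * n * (2 * n - 1) * p' n)))
      (fun n => u n - u' n) (fun n => v n - v' n) (fun n => p n - p' n) := by
  refine ⟨fun n => ?_, fun n => ?_, ?_, fun n => ?_⟩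
  · simp only [h.u_succ, h'.u_succ]; ring
  · simp only [h.v_succ, h'.v_succ]; push_cast; ring
  · simp only [h.p_zero, h'.p_zero, sub_zero]
  · simp only [h.p_succ, h'.p_succ]

theorem IsOSRec.linear_comb {R b : ℝ} {F u v p F' u' v' p' : ℕ → ℂ} (h : IsOSRec R b F u v p)
    (h' : IsOSRec R b F' u' v' p') (s t : ℂ) :
    IsOSRec R b (fun n => s * F n + t * F' n) (fun n => s * u n + t * u' n)
      (fun n => s * v n + t * v' n) (fun n => s * p n + t * p' n) := by
  refine ⟨fun n => ?_, fun n => ?_, ?_, fun n => ?_⟩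
  · simp only [h.u_succ, h'.u_succ]; ring
  · simp only [h.v_succ, h'.v_succ]; ring
  · simp only [h.p_zero, h'.p_zero, mul_zero, add_zero]
  · simp only [h.p_succ, h'.p_succ]

/-- The weighted sum of the Taylor coefficients of an even solution with initial data `u₀`, `v₀`. -/
noncomputable def endpointSum (c : ℕ → ℂ) (u₀ v₀ : ℂ) (R b : ℝ) : ℂ :=
  ∑' n, c n * (osRec R b 0 u₀ v₀ n).1

theorem abs_le_of_abs_sub_le {x y r B : ℝ} (h : |x - y| ≤ r) (hy : |y| + r ≤ B) : |x| ≤ B := by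
  have := abs_sub_abs_le_abs_sub x y
  linarith

theorem osBound_osRec {R b : ℝ} {u₀ v₀ : ℂ} (hR : |R| ≤ 5816) (hb : |b| ≤ 4298)
    (hu : ‖u₀‖ ≤ 1) (hv : ‖v₀‖ ≤ 4000) :
    OSBound 1 (fun n => (osRec R b 0 u₀ v₀ n).1) (fun n => (osRec R b 0 u₀ v₀ n).2.1)
      (fun n => (osRec R b 0 u₀ v₀ n).2.2) :=
  (isOSRec_osRec R b 0 u₀ v₀).osBound zero_le_one hR hb hu (by simpa [osRec] using hv)
    fun n => by simp only [Pi.zero_apply, norm_zero]; positivity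

theorem nearlyAffine_endpointSum {c : ℕ → ℂ} (hc : IsEndpointWeight c) {u₀ v₀ : ℂ}
    {R₀ b₀ r : ℝ} (hr : 0 ≤ r) (hR₀ : |R₀| + r ≤ 5816) (hb₀ : |b₀| + r ≤ 4298)
    (hu : ‖u₀‖ ≤ 1) (hv : ‖v₀‖ ≤ 4000) :
    ∃ fR fb, NearlyAffine R₀ b₀ r (10 ^ 48) (endpointSum c u₀ v₀) fR fb := by
  have bd : ∀ R b, |R - R₀| ≤ r → |b - b₀| ≤ r →
      OSBound 1 (fun n => (osRec R b 0 u₀ v₀ n).1) (fun n => (osRec R b 0 u₀ v₀ n).2.1)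
      (fun n => (osRec R b 0 u₀ v₀ n).2.2) := fun R b h h' =>
    osBound_osRec (abs_le_of_abs_sub_le h hR₀) (abs_le_of_abs_sub_le h' hb₀) hu hv
  have diff : ∀ R b R' b' δ, |R - R₀| ≤ r → |b - b₀| ≤ r → |R' - R₀| ≤ r → |b' - b₀| ≤ r →
      |R - R'| ≤ δ → |b - b'| ≤ δ →
      OSBound δ (fun n => (osRec R b 0 u₀ v₀ n).1 - (osRec R' b' 0 u₀ v₀ n).1)
        (fun n => (osRec R b 0 u₀ v₀ n).2.1 - (osRec R' b' 0 u₀ v₀ n).2.1)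
        (fun n => (osRec R b 0 u₀ v₀ n).2.2 - (osRec R' b' 0 u₀ v₀ n).2.2) := by
    intro R b R' b' δ h1 h2 h3 h4 h5 h6
    have hδ : 0 ≤ δ := (abs_nonneg _).trans h5
    refine ((isOSRec_osRec R b 0 u₀ v₀).sub (isOSRec_osRec R' b' 0 u₀ v₀)).osBound hδ
      (abs_le_of_abs_sub_le h1 hR₀) (abs_le_of_abs_sub_le h2 hb₀) ?_ ?_ fun n => ?_
    · simpa [osRec] using hδ
    · simpa [osRec] using hδ
    · have := (bd R' b' h3 h4).perturbation_le zero_le_one h5 h6 n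
      simp only [Pi.zero_apply, sub_zero, zero_add]
      refine this.trans ?_
      rw [mul_one]
      gcongr
      norm_num
  have h0 : |R₀ - R₀| ≤ r := by simpa using hr
  have h0' : |b₀ - b₀| ≤ r := by simpa using hr
  set u := fun n => (osRec R₀ b₀ 0 u₀ v₀ n).1 with hu_def
  set v := fun n => (osRec R₀ b₀ 0 u₀ v₀ n).2.1 with hv_def
  set p := fun n => (osRec R₀ b₀ 0 u₀ v₀ n).2.2 with hp_def
  have hcen : OSBound 1 u v p := bd R₀ b₀ h0 h0'
  set FR : ℕ → ℂ := fun n => I * (2 * u n - 2 * n * (2 * n - 1) * p n) with hFR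
  set Fb : ℕ → ℂ := fun n => I * v n with hFb
  have hlR := isOSRec_osRec R₀ b₀ FR 0 0
  have hlb := isOSRec_osRec R₀ b₀ Fb 0 0
  have hlin : ∀ s t δ : ℝ, |s| ≤ δ → |t| ≤ δ →
      OSBound δ (fun n => s * (osRec R₀ b₀ FR 0 0 n).1 + t * (osRec R₀ b₀ Fb 0 0 n).1)
        (fun n => s * (osRec R₀ b₀ FR 0 0 n).2.1 + t * (osRec R₀ b₀ Fb 0 0 n).2.1)
        (fun n => s * (osRec R₀ b₀ FR 0 0 n).2.2 + t * (osRec R₀ b₀ Fb 0 0 n).2.2) := by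
    intro s t δ hs ht
    have hδ : 0 ≤ δ := (abs_nonneg _).trans hs
    refine (hlR.linear_comb hlb s t).osBound hδ
      (abs_le_of_abs_sub_le h0 hR₀) (abs_le_of_abs_sub_le h0' hb₀) ?_ ?_ fun n => ?_
    · simpa [osRec] using hδ
    · simpa [osRec] using hδ
    · have := hcen.perturbation_le zero_le_one hs ht n
      rw [show (s : ℂ) * FR n + t * Fb n
        = I * t * v n + I * s * (2 * u n - 2 * n * (2 * n - 1) * p n) by
          simp only [hFR, hFb]; ring]
      refine this.trans ?_
      rw [mul_one]
      gcongr
      norm_num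
  have hsumR : Summable fun n => c n * (osRec R₀ b₀ FR 0 0 n).1 := by
    have := hlin 1 0 1 (by simp) (by simp)
    simpa using hc.summable this.u_le
  have hsumb : Summable fun n => c n * (osRec R₀ b₀ Fb 0 0 n).1 := by
    have := hlin 0 1 1 (by simp) (by simp)
    simpa using hc.summable this.u_le
  refine ⟨∑' n, c n * (osRec R₀ b₀ FR 0 0 n).1, ∑' n, c n * (osRec R₀ b₀ Fb 0 0 n).1,
    fun R b h1 h2 => ?_, fun R b R' b' δ h1 h2 h3 h4 h5 h6 => ?_,
    fun R b R' b' δ h1 h2 h3 h4 h5 h6 => ?_⟩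
  · simpa [endpointSum] using hc.norm_tsum_le zero_le_one (bd R b h1 h2).u_le
  · have := hc.norm_tsum_le ((abs_nonneg _).trans h5) (diff R b R' b' δ h1 h2 h3 h4 h5 h6).u_le
    rw [endpointSum, endpointSum,
      ← (hc.summable (bd R b h1 h2).u_le).tsum_sub (hc.summable (bd R' b' h3 h4).u_le)]
    simpa only [mul_sub] using this
  · have hδ : 0 ≤ δ := (abs_nonneg _).trans h5
    have hl := hlin (R - R') (b - b') δ h5 h6
    have hd := diff R' b' R₀ b₀ r h3 h4 h0 h0' h3 h4
    have rec2 := ((isOSRec_osRec R b 0 u₀ v₀).sub (isOSRec_osRec R' b' 0 u₀ v₀)).sub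
      (hlR.linear_comb hlb ((R - R' : ℝ) : ℂ) ((b - b' : ℝ) : ℂ))
    have hrδ : 0 ≤ r * δ := mul_nonneg hr hδ
    have hbound := rec2.osBound hrδ
      (abs_le_of_abs_sub_le h1 hR₀) (abs_le_of_abs_sub_le h2 hb₀) (by simpa [osRec] using hrδ)
      (by simpa [osRec] using hrδ) (fun n => by
        have e1 := hl.perturbation_le hδ h1 h2 n
        have e2 := hd.perturbation_le hr h5 h6 n
        refine (norm_add_le_of_le (r₁ := 500 * (δ * r) * majorant (n + 1)) (le_trans
          (le_of_eq (congrArg _ ?_)) e2) e1).trans (le_of_eq (by ring))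
        simp only [hFR, hFb, hu_def, hv_def, hp_def, Pi.zero_apply]
        ring)
    have := hc.norm_tsum_le hrδ hbound.u_le
    refine (le_of_eq (congrArg _ ?_)).trans this
    rw [endpointSum, endpointSum, ← tsum_mul_left, ← tsum_mul_left,
      ← (hc.summable (bd R b h1 h2).u_le).tsum_sub (hc.summable (bd R' b' h3 h4).u_le),
      ← (hsumR.mul_left _).tsum_add (hsumb.mul_left _),
      ← ((hc.summable (bd R b h1 h2).u_le).sub (hc.summable (bd R' b' h3 h4).u_le)).tsum_sub
        ((hsumR.mul_left _).add (hsumb.mul_left _))]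
    refine tsum_congr fun n => ?_
    ring

/-- A formal combination `c0 + c1 i + c2 i² + c3 i³` with natural coefficients. -/
structure RootSum where
  c0 : ℕ
  c1 : ℕ
  c2 : ℕ
  c3 : ℕ

namespace RootSum

def add (x y : RootSum) : RootSum :=
  ⟨x.c0 + y.c0, x.c1 + y.c1, x.c2 + y.c2, x.c3 + y.c3⟩

def smul (n : ℕ) (x : RootSum) : RootSum :=
  ⟨n * x.c0, n * x.c1, n * x.c2, n * x.c3⟩

/-- Multiplication by `i`. -/
def rot (x : RootSum) : RootSum :=
  ⟨x.c3, x.c0, x.c1, x.c2⟩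

def mul (x y : RootSum) : RootSum :=
  add (add (smul x.c0 y) (smul x.c1 y.rot)) (add (smul x.c2 y.rot.rot) (smul x.c3 y.rot.rot.rot))

/-- Both the real and the imaginary part are at most `q` in absolute value. -/
def IsSmall (x : RootSum) (q : ℕ) : Prop :=
  (x.c0 ≤ x.c2 + q ∧ x.c2 ≤ x.c0 + q) ∧ (x.c1 ≤ x.c3 + q ∧ x.c3 ≤ x.c1 + q)

instance (x : RootSum) (q : ℕ) : Decidable (x.IsSmall q) :=
  inferInstanceAs (Decidable (_ ∧ _))

end RootSum

open RootSum

structure SeriesState where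
  e : RootSum
  w : RootSum
  p : RootSum
  y : RootSum
  z : RootSum

def SeriesState.step (S R b n : ℕ) (s : SeriesState) : SeriesState :=
  let e := smul S (add s.e s.w)
  let q := S * ((2 * n + 1) * (2 * n + 2))
  { e := e
    w := add (smul S s.w)
      (rot (add (smul b s.w)
        (smul R (add (smul 2 s.e) (smul (2 * n * (2 * n - 1) * S) s.p.rot.rot)))))
    p := s.w
    y := add (smul q s.y) e
    z := add (smul q s.z) (smul (2 * n + 2) e) }

def seriesState (S R b : ℕ) (e w : RootSum) (N : ℕ) : SeriesState :=
  Nat.rec ⟨e, w, ⟨0, 0, 0, 0⟩, e, ⟨0, 0, 0, 0⟩⟩ (fun n s => s.step S R b n) N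

def seriesDet (S R b N : ℕ) : RootSum :=
  let s := seriesState S R b ⟨1, 0, 0, 0⟩ ⟨0, 0, 0, 0⟩ N
  let s' := seriesState S R b ⟨0, 0, 0, 0⟩ ⟨1, 0, 0, 0⟩ N
  add (mul s.y s'.z) (mul s.z s'.y).rot.rot

def scale : ℕ := 2 ^ 350
def reynolds : ℕ := 13336301706658186491644505510783378770334531608055525737522356324090476241430184732047213813745971590042518960
def shift : ℕ := 9852423050947443262356546793941949303167799583299666697154033097518167277227675610962207114159546941054653375

def denom : ℕ := scale ^ 400 * (2 * 400)!

theorem seriesDet_center :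
    (add (smul (2 ^ 310) (seriesDet scale reynolds shift 400))
      (smul (denom ^ 2) ⟨0, 0, 0, 0⟩)).IsSmall (denom ^ 2) := by
  decide +kernel

theorem seriesDet_reynolds :
    (add (smul (2 ^ 310) (seriesDet scale (reynolds + 2 ^ 40) shift 400))
      (smul (denom ^ 2) ⟨2414523999, 0, 0, 4735504955⟩)).IsSmall (denom ^ 2) := by
  decide +kernel

theorem seriesDet_shift :
    (add (smul (2 ^ 310) (seriesDet scale reynolds (shift + 2 ^ 40) 400))
      (smul (denom ^ 2) ⟨0, 5997362132, 3160053579, 0⟩)).IsSmall (denom ^ 2) := by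
  decide +kernel

theorem seriesState_value :
    denom + (seriesState scale reynolds shift ⟨0, 0, 0, 0⟩ ⟨1, 0, 0, 0⟩ 400).y.c2 ≤
      (seriesState scale reynolds shift ⟨0, 0, 0, 0⟩ ⟨1, 0, 0, 0⟩ 400).y.c0 := by
  decide +kernel

/-- The complex number represented by a formal combination of powers of `i`. -/
noncomputable def RootSum.toComplex (x : RootSum) : ℂ :=
  ((x.c0 : ℂ) - x.c2) + ((x.c1 : ℂ) - x.c3) * I

theorem RootSum.toComplex_add (x y : RootSum) :
    (add x y).toComplex = x.toComplex + y.toComplex := by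
  simp only [toComplex, add]; push_cast; ring

theorem RootSum.toComplex_smul (n : ℕ) (x : RootSum) :
    (smul n x).toComplex = n * x.toComplex := by
  simp only [toComplex, smul]; push_cast; ring

theorem RootSum.toComplex_rot (x : RootSum) : x.rot.toComplex = I * x.toComplex := by
  simp only [toComplex, rot]
  linear_combination ((x.c3 : ℂ) - x.c1) * I_sq

theorem RootSum.toComplex_mul (x y : RootSum) :
    (mul x y).toComplex = x.toComplex * y.toComplex := by
  simp only [mul, toComplex_add, toComplex_smul, toComplex_rot]
  rw [show x.toComplex = ((x.c0 : ℂ) - x.c2) + ((x.c1 : ℂ) - x.c3) * I from rfl]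
  linear_combination ((x.c2 : ℂ) + x.c3 * I) * y.toComplex * I_sq

theorem RootSum.IsSmall.norm_le {x : RootSum} {q : ℕ} (h : x.IsSmall q) :
    ‖x.toComplex‖ ≤ 2 * q := by
  obtain ⟨⟨h1, h2⟩, h3, h4⟩ := h
  have hre : x.toComplex.re = (x.c0 : ℝ) - x.c2 := by simp [toComplex]
  have him : x.toComplex.im = (x.c1 : ℝ) - x.c3 := by simp [toComplex]
  have h1' : (x.c0 : ℝ) ≤ x.c2 + q := by exact_mod_cast h1
  have h2' : (x.c2 : ℝ) ≤ x.c0 + q := by exact_mod_cast h2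
  have h3' : (x.c1 : ℝ) ≤ x.c3 + q := by exact_mod_cast h3
  have h4' : (x.c3 : ℝ) ≤ x.c1 + q := by exact_mod_cast h4
  have e1 : |x.toComplex.re| ≤ q := by rw [hre, abs_le]; constructor <;> linarith
  have e2 : |x.toComplex.im| ≤ q := by rw [him, abs_le]; constructor <;> linarith
  linarith [Complex.norm_le_abs_re_add_abs_im x.toComplex]

/-- Partial sums of `endpointSum`. -/
noncomputable def endpointPartialSum (c : ℕ → ℂ) (u₀ v₀ : ℂ) (R b : ℝ) (N : ℕ) : ℂ :=
  ∑ n ∈ Finset.range (N + 1), c n * (osRec R b 0 u₀ v₀ n).1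

theorem toComplex_seriesState {S : ℕ} (hS : S ≠ 0) (R b : ℕ) (e w : RootSum) (N : ℕ) :
    let s := seriesState S R b e w N
    let x := osRec (R / S) (b / S) 0 e.toComplex w.toComplex N
    s.e.toComplex = S ^ N * x.1 ∧ s.w.toComplex = S ^ N * x.2.1 ∧
    S * s.p.toComplex = S ^ N * x.2.2 ∧
    s.y.toComplex = S ^ N * ((2 * N)! : ℂ)
      * endpointPartialSum valueWeight e.toComplex w.toComplex (R / S) (b / S) N ∧
    s.z.toComplex = S ^ N * ((2 * N)! : ℂ)
      * endpointPartialSum slopeWeight e.toComplex w.toComplex (R / S) (b / S) N := by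
  have hS' : (S : ℂ) ≠ 0 := by exact_mod_cast hS
  induction N with
  | zero =>
    simp [seriesState, osRec, endpointPartialSum, valueWeight, slopeWeight, RootSum.toComplex]
  | succ N ih =>
    obtain ⟨he, hw, hp, hy, hz⟩ := ih
    have step : seriesState S R b e w (N + 1)
      = (seriesState S R b e w N).step S R b N := rfl
    intro s x
    have he' : s.e.toComplex = S ^ (N + 1) * x.1 := by
      simp only [s, x, step, SeriesState.step, RootSum.toComplex_smul, RootSum.toComplex_add,
        he, hw, osRec]
      ring
    have hfac : ((2 * (N + 1))! : ℂ) = (2 * N + 1) * (2 * N + 2) * ((2 * N)! : ℂ) := by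
      rw [show 2 * (N + 1) = 2 * N + 1 + 1 by ring, Nat.factorial_succ, Nat.factorial_succ]
      push_cast; ring
    have hfac0 : ((2 * (N + 1))! : ℂ) ≠ 0 := by exact_mod_cast Nat.factorial_ne_zero _
    refine ⟨he', ?_, ?_, ?_, ?_⟩
    · have hidx : ((2 * N * (2 * N - 1) : ℕ) : ℂ) = 2 * N * (2 * N - 1) := by
        rcases Nat.eq_zero_or_pos N with rfl | hN
        · simp
        · push_cast [Nat.cast_sub (show 1 ≤ 2 * N by omega)]; ring
      simp only [s, x, step, SeriesState.step, RootSum.toComplex_smul, RootSum.toComplex_add,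
        RootSum.toComplex_rot, he, hw, osRec, Pi.zero_apply, Nat.cast_mul (_ * _) S, hidx]
      push_cast
      field_simp
      linear_combination (2 * N * (2 * N - 1) * I * R : ℂ) * (S * I ^ 2 * hp)
        + (2 * N * (2 * N - 1) * I * R * S * S ^ N : ℂ)
          * (osRec (R / S) (b / S) 0 e.toComplex w.toComplex N).2.2 * I_sq
    · simp only [s, x, step, SeriesState.step, hw, osRec]
      ring
    · have : s.y.toComplex = S * ((2 * N + 1) * (2 * N + 2))
          * (seriesState S R b e w N).y.toComplex + s.e.toComplex := by
        simp only [s, step, SeriesState.step, RootSum.toComplex_smul, RootSum.toComplex_add]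
        push_cast; ring
      rw [this, he', hy, endpointPartialSum, endpointPartialSum, Finset.sum_range_succ _ (N + 1)]
      have hwt : ((2 * (N + 1))! : ℂ) * valueWeight (N + 1) = 1 := mul_one_div_cancel hfac0
      linear_combination (-(S : ℂ) ^ (N + 1) * x.1) * hwt
        - (S : ℂ) ^ (N + 1) * (∑ n ∈ Finset.range (N + 1),
          valueWeight n * (osRec (R / S) (b / S) 0 e.toComplex w.toComplex n).1) * hfac
    · have : s.z.toComplex = S * ((2 * N + 1) * (2 * N + 2))
          * (seriesState S R b e w N).z.toComplex + (2 * N + 2) * s.e.toComplex := by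
        simp only [s, step, SeriesState.step, RootSum.toComplex_smul, RootSum.toComplex_add]
        push_cast; ring
      rw [this, he', hz, endpointPartialSum, endpointPartialSum, Finset.sum_range_succ _ (N + 1)]
      have hwt : ((2 * (N + 1))! : ℂ) * slopeWeight (N + 1) = 2 * N + 2 := by
        rw [slopeWeight, mul_div_cancel₀ _ hfac0]; push_cast; ring
      linear_combination (-(S : ℂ) ^ (N + 1) * x.1) * hwt
        - (S : ℂ) ^ (N + 1) * (∑ n ∈ Finset.range (N + 1),
          slopeWeight n * (osRec (R / S) (b / S) 0 e.toComplex w.toComplex n).1) * hfac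

theorem toComplex_seriesDet {S : ℕ} (hS : S ≠ 0) (R b N : ℕ) :
    (seriesDet S R b N).toComplex = (S ^ N * ((2 * N)! : ℂ)) ^ 2 *
      (endpointPartialSum valueWeight 1 0 (R / S) (b / S) N
          * endpointPartialSum slopeWeight 0 1 (R / S) (b / S) N
        - endpointPartialSum slopeWeight 1 0 (R / S) (b / S) N
          * endpointPartialSum valueWeight 0 1 (R / S) (b / S) N) := by
  have h0 : (⟨0, 0, 0, 0⟩ : RootSum).toComplex = 0 := by simp [RootSum.toComplex]
  have h1 : (⟨1, 0, 0, 0⟩ : RootSum).toComplex = 1 := by simp [RootSum.toComplex]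
  obtain ⟨-, -, -, hy, hz⟩ := toComplex_seriesState hS R b ⟨1, 0, 0, 0⟩ ⟨0, 0, 0, 0⟩ N
  obtain ⟨-, -, -, hy', hz'⟩ := toComplex_seriesState hS R b ⟨0, 0, 0, 0⟩ ⟨1, 0, 0, 0⟩ N
  rw [h0, h1] at hy hz hy' hz'
  simp only [seriesDet, RootSum.toComplex_add, RootSum.toComplex_rot, RootSum.toComplex_mul,
    hy, hz, hy', hz']
  linear_combination (S ^ N * ((2 * N)! : ℂ)) ^ 2 * (
        endpointPartialSum slopeWeight 1 0 (R / S) (b / S) N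
          * endpointPartialSum valueWeight 0 1 (R / S) (b / S) N) * I_sq

set_option exponentiation.threshold 400

/-- The determinant whose vanishing allows an even solution with `φ(1) = φ'(1) = 0`. -/
noncomputable def endpointDet (R b : ℝ) : ℂ :=
  endpointSum valueWeight 1 0 R b * endpointSum slopeWeight 0 1 R b
    - endpointSum slopeWeight 1 0 R b * endpointSum valueWeight 0 1 R b

theorem norm_endpointSum_le {c : ℕ → ℂ} (hc : IsEndpointWeight c) {R b : ℝ} {u₀ v₀ : ℂ}
    (hR : |R| ≤ 5816) (hb : |b| ≤ 4298) (hu : ‖u₀‖ ≤ 1) (hv : ‖v₀‖ ≤ 4000) :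
    ‖endpointSum c u₀ v₀ R b‖ ≤ 10 ^ 48 := by
  simpa [endpointSum] using hc.norm_tsum_le zero_le_one (osBound_osRec hR hb hu hv).u_le

theorem norm_endpointSum_sub_le {c : ℕ → ℂ} (hc : IsEndpointWeight c) {R b : ℝ} {u₀ v₀ : ℂ}
    (hR : |R| ≤ 5816) (hb : |b| ≤ 4298) (hu : ‖u₀‖ ≤ 1) (hv : ‖v₀‖ ≤ 4000) :
    ‖endpointSum c u₀ v₀ R b - endpointPartialSum c u₀ v₀ R b 400‖ ≤ 2 / 10 ^ 150 := by
  simpa [endpointSum, endpointPartialSum] using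
    hc.norm_tsum_sub_sum_le zero_le_one (osBound_osRec hR hb hu hv).u_le

theorem norm_mul_sub_mul_le {x y x' y' : ℂ} {B τ : ℝ} (hx : ‖x‖ ≤ B) (hy : ‖y‖ ≤ B)
    (hx' : ‖x - x'‖ ≤ τ) (hy' : ‖y - y'‖ ≤ τ) : ‖x * y - x' * y'‖ ≤ 2 * B * τ + τ ^ 2 := by
  have hB : 0 ≤ B := (norm_nonneg _).trans hx
  have hτ : 0 ≤ τ := (norm_nonneg _).trans hx'
  rw [show x * y - x' * y' = x * (y - y') + y * (x - x') - (x - x') * (y - y') by ring]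
  refine (norm_sub_le _ _).trans ((add_le_add (norm_add_le _ _) le_rfl).trans ?_)
  simp only [norm_mul]
  nlinarith [mul_le_mul hx hy' (norm_nonneg _) hB, mul_le_mul hy hx' (norm_nonneg _) hB,
    mul_le_mul hx' hy' (norm_nonneg _) hτ]

theorem norm_endpointDet_sub_le {R b : ℝ} (hR : |R| ≤ 5816) (hb : |b| ≤ 4298) :
    ‖endpointDet R b - (endpointPartialSum valueWeight 1 0 R b 400
        * endpointPartialSum slopeWeight 0 1 R b 400
      - endpointPartialSum slopeWeight 1 0 R b 400
        * endpointPartialSum valueWeight 0 1 R b 400)‖ ≤ 1 / 2 ^ 310 := by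
  have h0 : ‖(0 : ℂ)‖ ≤ 1 := by simp
  have h1 : ‖(1 : ℂ)‖ ≤ 1 := by simp
  have h0' : ‖(0 : ℂ)‖ ≤ 4000 := by simp
  have h1' : ‖(1 : ℂ)‖ ≤ 4000 := by norm_num
  have e1 := norm_mul_sub_mul_le (norm_endpointSum_le isEndpointWeight_value hR hb h1 h0')
    (norm_endpointSum_le isEndpointWeight_slope hR hb h0 h1')
    (norm_endpointSum_sub_le isEndpointWeight_value hR hb h1 h0')
    (norm_endpointSum_sub_le isEndpointWeight_slope hR hb h0 h1')
  have e2 := norm_mul_sub_mul_le (norm_endpointSum_le isEndpointWeight_slope hR hb h1 h0')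
    (norm_endpointSum_le isEndpointWeight_value hR hb h0 h1')
    (norm_endpointSum_sub_le isEndpointWeight_slope hR hb h1 h0')
    (norm_endpointSum_sub_le isEndpointWeight_value hR hb h0 h1')
  rw [endpointDet, sub_sub_sub_comm]
  refine (norm_sub_le _ _).trans ((add_le_add e1 e2).trans ?_)
  norm_num

theorem scale_pos : 0 < scale := by unfold scale; positivity

theorem denom_pos : 0 < denom := by unfold denom; have := scale_pos; positivity

theorem norm_add_one_div_mul_le {m q : ℝ} {x y : ℂ} (hm : 0 < m) (hq : 0 < q)
    (h : ‖(m : ℂ) * (q * x) + q * y‖ ≤ 2 * q) : ‖x + (1 / m : ℝ) * y‖ ≤ 2 * (1 / m) := by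
  have hm' : (m : ℂ) ≠ 0 := by exact_mod_cast hm.ne'
  rw [show (m : ℂ) * (q * x) + q * y = ((m * q : ℝ) : ℂ) * (x + (1 / m : ℝ) * y) by
    push_cast; field_simp, norm_mul, Complex.norm_real, Real.norm_of_nonneg (by positivity)] at h
  rw [mul_one_div, le_div_iff₀ hm]
  refine le_of_mul_le_mul_left ?_ hq
  linarith

theorem norm_endpointDet_add_le {R b : ℕ} {x : RootSum}
    (h : (add (smul (2 ^ 310) (seriesDet scale R b 400)) (smul (denom ^ 2) x)).IsSmall (denom ^ 2))
    (hR : |(R / scale : ℝ)| ≤ 5816) (hb : |(b / scale : ℝ)| ≤ 4298) :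
    ‖endpointDet (R / scale) (b / scale) + (1 / 2 ^ 310 : ℝ) * x.toComplex‖
      ≤ 3 * (1 / 2 ^ 310) := by
  have e1 := norm_endpointDet_sub_le hR hb
  have e2 := h.norm_le
  rw [RootSum.toComplex_add, RootSum.toComplex_smul, RootSum.toComplex_smul,
    toComplex_seriesDet scale_pos.ne'] at e2
  set P := endpointPartialSum valueWeight 1 0 (R / scale) (b / scale) 400
        * endpointPartialSum slopeWeight 0 1 (R / scale) (b / scale) 400
      - endpointPartialSum slopeWeight 1 0 (R / scale) (b / scale) 400
        * endpointPartialSum valueWeight 0 1 (R / scale) (b / scale) 400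
  have hd : ((scale : ℂ) ^ 400 * ((2 * 400)! : ℂ)) = (denom : ℂ) := by
    unfold denom; push_cast; rfl
  rw [hd] at e2
  have hq : (0 : ℝ) < denom ^ 2 := by have := denom_pos; positivity
  have e3 : ‖P + (1 / 2 ^ 310 : ℝ) * x.toComplex‖ ≤ 2 * (1 / 2 ^ 310) := by
    refine norm_add_one_div_mul_le (by positivity) hq ?_
    simpa only [Nat.cast_pow, Nat.cast_ofNat, Complex.ofReal_pow, Complex.ofReal_ofNat,
      Complex.ofReal_natCast] using e2
  have e4 : endpointDet (R / scale) (b / scale) + (1 / 2 ^ 310 : ℝ) * x.toComplex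
    = (endpointDet (R / scale) (b / scale) - P) + (P + (1 / 2 ^ 310 : ℝ) * x.toComplex) := by ring
  rw [e4]
  refine (norm_add_le _ _).trans ((add_le_add e1 e3).trans (le_of_eq (by ring)))

theorem reynolds_bound : |(reynolds / scale : ℝ)| + 1 / 2 ^ 310 ≤ 5816 := by
  rw [abs_of_nonneg (by positivity)]; norm_num [reynolds, scale]

theorem shift_bound : |(shift / scale : ℝ)| + 1 / 2 ^ 310 ≤ 4298 := by
  rw [abs_of_nonneg (by positivity)]; norm_num [shift, scale]

theorem lt_of_abs_sub_reynolds_le {R : ℝ} (hR : |R - reynolds / scale| ≤ 1 / 2 ^ 310) :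
    5000 < R := by
  have h1 : (5001 : ℝ) ≤ reynolds / scale := by norm_num [reynolds, scale]
  have h2 : (1 : ℝ) / 2 ^ 310 < 1 := by norm_num
  linarith [(abs_le.1 hR).1]

theorem add_two_pow_div_scale (k : ℕ) :
    ((k + 2 ^ 40 : ℕ) : ℝ) / scale = k / scale + 1 / 2 ^ 310 := by
  push_cast
  rw [add_div]
  congr 1
  norm_num [scale]

/-- The parameters of a neutral mode. -/
theorem exists_endpointDet_eq_zero : ∃ R b : ℝ, |R - reynolds / scale| ≤ 1 / 2 ^ 310 ∧
    |b - shift / scale| ≤ 1 / 2 ^ 310 ∧ endpointDet R b = 0 := by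
  have hr : (0 : ℝ) ≤ 1 / 2 ^ 310 := by positivity
  have h0 : ‖(0 : ℂ)‖ ≤ 1 := by simp
  have h1 : ‖(1 : ℂ)‖ ≤ 1 := by simp
  have h0' : ‖(0 : ℂ)‖ ≤ 4000 := by simp
  have h1' : ‖(1 : ℂ)‖ ≤ 4000 := by norm_num
  obtain ⟨_, _, hf⟩ := nearlyAffine_endpointSum isEndpointWeight_value hr reynolds_bound
    shift_bound h1 h0'
  obtain ⟨_, _, hg⟩ := nearlyAffine_endpointSum isEndpointWeight_slope hr reynolds_bound
    shift_bound h1 h0'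
  obtain ⟨_, _, hh⟩ := nearlyAffine_endpointSum isEndpointWeight_value hr reynolds_bound
    shift_bound h0 h1'
  obtain ⟨_, _, hk⟩ := nearlyAffine_endpointSum isEndpointWeight_slope hr reynolds_bound
    shift_bound h0 h1'
  have hD := NearlyAffine.mul_sub_mul hr (by norm_num) (by positivity) hf hg hh hk
  have bR : |(reynolds / scale : ℝ)| ≤ 5816 := by linarith [reynolds_bound]
  have bb : |(shift / scale : ℝ)| ≤ 4298 := by linarith [shift_bound]
  have bR' : |((reynolds + 2 ^ 40 : ℕ) / scale : ℝ)| ≤ 5816 := by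
    rw [add_two_pow_div_scale]
    exact (abs_add_le _ _).trans (by rw [abs_of_nonneg hr]; exact reynolds_bound)
  have bb' : |((shift + 2 ^ 40 : ℕ) / scale : ℝ)| ≤ 4298 := by
    rw [add_two_pow_div_scale]
    exact (abs_add_le _ _).trans (by rw [abs_of_nonneg hr]; exact shift_bound)
  have n0 := norm_endpointDet_add_le seriesDet_center bR bb
  have nR := norm_endpointDet_add_le seriesDet_reynolds bR' bb
  have nb := norm_endpointDet_add_le seriesDet_shift bR bb'
  rw [add_two_pow_div_scale] at nR nb
  refine NearlyAffine.exists_zero (jR := ⟨-2414523999, 4735504955⟩)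
    (jb := ⟨3160053579, -5997362132⟩) (κ := 1 / 40000000) (ε := 3)
    hD (by positivity) (by norm_num) ?_ ?_ ?_ ?_ ?_ ?_ ?_ ?_
  · simpa [RootSum.toComplex, endpointDet] using n0
  · convert nR using 2
    rw [endpointDet, sub_eq_add_neg, ← mul_neg]
    congr 2
    apply Complex.ext <;> simp [RootSum.toComplex]
  · convert nb using 2
    rw [endpointDet, sub_eq_add_neg, ← mul_neg]
    congr 2
    apply Complex.ext <;> simp [RootSum.toComplex]
  · norm_num
  · norm_num
  · norm_num
  · norm_num
  · norm_num

theorem endpointSum_value_ne_zero {R b : ℝ} (hR : |R - reynolds / scale| ≤ 1 / 2 ^ 310)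
    (hb : |b - shift / scale| ≤ 1 / 2 ^ 310) : endpointSum valueWeight 0 1 R b ≠ 0 := by
  have hr : (0 : ℝ) ≤ 1 / 2 ^ 310 := by positivity
  have h0 : ‖(0 : ℂ)‖ ≤ 1 := by simp
  have h1' : ‖(1 : ℂ)‖ ≤ 4000 := by norm_num
  obtain ⟨_, _, hh⟩ := nearlyAffine_endpointSum isEndpointWeight_value hr reynolds_bound
    shift_bound h0 h1'
  have e1 := hh.lipschitz R b (reynolds / scale) (shift / scale) _ hR hb (by simp) (by simp) hR hb
  have e2 := norm_endpointSum_sub_le isEndpointWeight_value (R := reynolds / scale)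
    (b := shift / scale) (by linarith [reynolds_bound]) (by linarith [shift_bound]) h0 h1'
  obtain ⟨-, -, -, hy, -⟩ := toComplex_seriesState scale_pos.ne' reynolds shift
    ⟨0, 0, 0, 0⟩ ⟨1, 0, 0, 0⟩ 400
  have hd : ((scale : ℂ) ^ 400 * ((2 * 400)! : ℂ)) = ((denom : ℝ) : ℂ) := by
    unfold denom; push_cast; rfl
  have z0 : (⟨0, 0, 0, 0⟩ : RootSum).toComplex = 0 := by simp [RootSum.toComplex]
  have z1 : (⟨1, 0, 0, 0⟩ : RootSum).toComplex = 1 := by simp [RootSum.toComplex]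
  rw [hd, z0, z1] at hy
  have hy' := congrArg Complex.re hy
  rw [Complex.re_ofReal_mul] at hy'
  have hval : (denom : ℝ) + (seriesState scale reynolds shift ⟨0, 0, 0, 0⟩ ⟨1, 0, 0, 0⟩ 400).y.c2
      ≤ (seriesState scale reynolds shift ⟨0, 0, 0, 0⟩ ⟨1, 0, 0, 0⟩ 400).y.c0 := by
    exact_mod_cast seriesState_value
  generalize seriesState scale reynolds shift ⟨0, 0, 0, 0⟩ ⟨1, 0, 0, 0⟩ 400 = s at *
  have hre : s.y.toComplex.re = (s.y.c0 : ℝ) - s.y.c2 := by simp [RootSum.toComplex]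
  have hden : (0 : ℝ) < denom := by exact_mod_cast denom_pos
  set P := endpointPartialSum valueWeight 0 1 (reynolds / scale) (shift / scale) 400
  have hP : 1 ≤ P.re := by
    refine le_of_mul_le_mul_left ?_ hden
    linarith
  have hP' := hP.trans (Complex.re_le_norm P)
  intro hzero
  rw [hzero, zero_sub, norm_neg] at e1
  have e3 := norm_sub_norm_le P (endpointSum valueWeight 0 1 (reynolds / scale) (shift / scale))
  rw [norm_sub_rev] at e3
  have : (10 : ℝ) ^ 48 * (1 / 2 ^ 310) + 2 / 10 ^ 150 < 1 := by norm_num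
  linarith

/-- The sequence with the given terms at even indices and zeros at odd indices. -/
def evenExtend (u : ℕ → ℂ) (m : ℕ) : ℂ := if Even m then u (m / 2) else 0

theorem evenExtend_two_mul (u : ℕ → ℂ) (n : ℕ) : evenExtend u (2 * n) = u n := by
  simp [evenExtend]

theorem evenExtend_of_odd (u : ℕ → ℂ) {m : ℕ} (hm : Odd m) : evenExtend u m = 0 := by
  simp [evenExtend, Nat.not_even_iff_odd.2 hm]

theorem summable_majorant_mul_pow {r : ℝ} (hr : 0 ≤ r) :
    Summable fun n : ℕ => (majorant n : ℝ) / ((2 * n)! : ℝ) * r ^ (2 * n) := by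
  refine summable_of_ratio_norm_eventually_le (r := 1 / 2) (by norm_num) ?_
  filter_upwards [Filter.eventually_ge_atTop ⌈5940 * r ^ 2⌉₊] with n hn
  have hn' : 5940 * r ^ 2 ≤ n := Nat.ceil_le.1 hn
  rw [Real.norm_of_nonneg (by positivity), Real.norm_of_nonneg (by positivity), majorant_succ,
    show 2 * (n + 1) = 2 * n + 1 + 1 by ring, Nat.factorial_succ, Nat.factorial_succ]
  have key : 180 * ((n : ℝ) + 32) * r ^ 2 / ((2 * n + 1) * (2 * n + 2)) ≤ 1 / 2 := by
    rw [div_le_div_iff₀ (by positivity) (by norm_num)]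
    have : (0 : ℝ) ≤ n := n.cast_nonneg
    nlinarith [mul_le_mul_of_nonneg_left hn' (by positivity : (0 : ℝ) ≤ n + 32)]
  calc _ = 180 * ((n : ℝ) + 32) * r ^ 2 / ((2 * n + 1) * (2 * n + 2))
        * ((majorant n : ℝ) / ((2 * n)! : ℝ) * r ^ (2 * n)) := by
        push_cast; field_simp; ring
    _ ≤ _ := mul_le_mul_of_nonneg_right key (by positivity)

theorem entireEgf_evenExtend {u : ℕ → ℂ} {K : ℝ} (hu : ∀ n, ‖u n‖ ≤ K * majorant n) :
    EntireEgf (evenExtend u) := by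
  intro r hr
  rw [← Function.Injective.summable_iff (mul_right_injective₀ (two_ne_zero' ℕ))]
  · refine Summable.of_nonneg_of_le (fun n => by simp only [Function.comp_apply]; positivity)
      (fun n => ?_) ((summable_majorant_mul_pow hr).mul_left K)
    simp only [Function.comp_apply, evenExtend_two_mul]
    calc ‖u n‖ / ((2 * n)! : ℝ) * r ^ (2 * n)
        ≤ K * majorant n / ((2 * n)! : ℝ) * r ^ (2 * n) := by gcongr; exact hu n
      _ = _ := by ring
  · intro m hm
    rw [evenExtend_of_odd, norm_zero, zero_div, zero_mul]
    exact Nat.not_even_iff_odd.1 fun h => hm (h.two_dvd.imp fun _ h => h.symm)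

theorem egf_evenExtend_zero (u : ℕ → ℂ) : egf (evenExtend u) 0 = u 0 := by
  rw [egf, tsum_eq_single 0 fun m hm => by simp [hm]]
  simp [evenExtend]

theorem egf_evenExtend_neg (u : ℕ → ℂ) (z : ℂ) :
    egf (evenExtend u) (-z) = egf (evenExtend u) z := by
  refine tsum_congr fun m => ?_
  rcases Nat.even_or_odd m with h | h
  · rw [h.neg_pow]
  · simp [evenExtend_of_odd u h]

theorem egf_evenExtend_one (u : ℕ → ℂ) :
    egf (evenExtend u) 1 = ∑' n, valueWeight n * u n := by
  rw [egf, ← (mul_right_injective₀ (two_ne_zero' ℕ)).tsum_eq]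
  · refine tsum_congr fun n => ?_
    rw [evenExtend_two_mul, one_pow, mul_one, valueWeight]
    ring
  · intro m hm
    by_contra h
    refine hm ?_
    dsimp only
    rw [evenExtend_of_odd, zero_div, zero_mul]
    exact Nat.not_even_iff_odd.1 fun h' => h (h'.two_dvd.imp fun _ h => h.symm)

theorem egf_evenExtend_shift_one {u : ℕ → ℂ} (hu : Summable fun n => slopeWeight n * u n) :
    egf (fun m => evenExtend u (m + 1)) 1 = ∑' n, slopeWeight n * u n := by
  rw [hu.tsum_eq_zero_add, egf, ← Function.Injective.tsum_eq (g := fun n : ℕ => 2 * n + 1)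
    (fun a b h => by simpa using h)]
  · simp only [slopeWeight, Nat.cast_zero, mul_zero, zero_div, zero_mul, zero_add]
    refine tsum_congr fun n => ?_
    rw [show 2 * n + 1 + 1 = 2 * (n + 1) by ring, evenExtend_two_mul, one_pow, mul_one,
      show 2 * (n + 1) = 2 * n + 1 + 1 by ring, Nat.factorial_succ (2 * n + 1)]
    have h1 : ((2 * n + 1)! : ℂ) ≠ 0 := by exact_mod_cast Nat.factorial_ne_zero _
    have h2 : ((n : ℂ) + 1) ≠ 0 := by exact_mod_cast n.succ_ne_zero
    have h3 : (2 * n + 1 + 1 : ℂ) ≠ 0 := by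
      rw [show (2 * n + 1 + 1 : ℂ) = 2 * (n + 1) by ring]
      exact mul_ne_zero two_ne_zero h2
    push_cast
    field_simp
    ring
  · intro m hm
    by_contra h
    refine hm ?_
    dsimp only
    rw [evenExtend_of_odd, zero_div, zero_mul]
    refine Nat.not_even_iff_odd.1 fun h' => h ?_
    have : Odd m := by
      rcases Nat.even_or_odd m with h'' | h''
      · exact absurd h' (Nat.not_even_iff_odd.2 h''.add_one)
      · exact h''
    exact this.imp fun _ h => h.symm

theorem IsOSRec.evenExtend_eq {R b : ℝ} {u v p : ℕ → ℂ} (h : IsOSRec R b 0 u v p) (m : ℕ) :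
    evenExtend u (m + 4) - 2 * evenExtend u (m + 2) + evenExtend u m
      - I * (b * (evenExtend u (m + 2) - evenExtend u m)
        - R * (m * (m - 1) * evenExtend u (m - 2 + 2) - m * (m - 1) * evenExtend u (m - 2))
        + 2 * R * evenExtend u m) = 0 := by
  obtain ⟨n, rfl | rfl⟩ := m.even_or_odd'
  · have hp : (2 * n : ℂ) * (2 * n - 1) * p n = 2 * n * (2 * n - 1)
        * (evenExtend u (2 * n - 2 + 2) - evenExtend u (2 * n - 2)) := by
      rcases n with _ | n
      · simp
      · rw [show 2 * (n + 1) - 2 = 2 * n by omega, show 2 * n + 2 = 2 * (n + 1) by ring,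
          evenExtend_two_mul, evenExtend_two_mul, h.p_succ, h.u_succ]
        ring
    rw [show 2 * n + 4 = 2 * (n + 1 + 1) by ring, show 2 * n + 2 = 2 * (n + 1) by ring,
      evenExtend_two_mul, evenExtend_two_mul, evenExtend_two_mul, h.u_succ (n + 1), h.v_succ,
      h.u_succ n, Pi.zero_apply]
    push_cast
    linear_combination (-I * R) * hp
  · have hodd : Odd (2 * n + 1) := odd_two_mul_add_one n
    have hz : (((2 * n + 1 : ℕ) : ℂ) * ((2 * n + 1 : ℕ) - 1)) * evenExtend u (2 * n + 1 - 2 + 2) = 0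
        ∧ (((2 * n + 1 : ℕ) : ℂ) * ((2 * n + 1 : ℕ) - 1)) * evenExtend u (2 * n + 1 - 2) = 0 := by
      rcases n with _ | n
      · simp
      · rw [show 2 * (n + 1) + 1 - 2 = 2 * n + 1 by omega,
          evenExtend_of_odd u (odd_two_mul_add_one n),
          evenExtend_of_odd u ((odd_two_mul_add_one n).add_even even_two)]
        simp
    rw [hz.1, hz.2, evenExtend_of_odd u hodd, evenExtend_of_odd u (hodd.add_even even_two),
      evenExtend_of_odd u (hodd.add_even (by decide))]
    ring

theorem IsOSRec.egf_eq {R b K : ℝ} {u v p : ℕ → ℂ} (h : IsOSRec R b 0 u v p)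
    (hu : ∀ n, ‖u n‖ ≤ K * majorant n) (z : ℂ) :
    egf (fun m => evenExtend u (m + 4)) z - 2 * egf (fun m => evenExtend u (m + 2)) z
      + egf (evenExtend u) z - I * ((b - R * z ^ 2) * (egf (fun m => evenExtend u (m + 2)) z
        - egf (evenExtend u) z) + 2 * R * egf (evenExtend u) z) = 0 := by
  have hf := entireEgf_evenExtend hu
  have hf2 : EntireEgf fun m => evenExtend u (m + 2) := hf.shift.shift
  have hf4 : EntireEgf fun m => evenExtend u (m + 4) := hf2.shift.shift
  have s0 := (hf.summable z).hasSum
  have s2 := (hf2.summable z).hasSum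
  have s4 := (hf4.summable z).hasSum
  have q0 := hf.hasSum_sq_mul z
  have q2 := hf2.hasSum_sq_mul z
  have total := ((s4.sub (s2.mul_left 2)).add s0).sub (((((s2.sub s0).mul_left (b : ℂ)).sub
    ((q2.sub q0).mul_left (R : ℂ))).add (s0.mul_left (2 * R : ℂ))).mul_left I)
  have hzero := total.unique (hasSum_zero.congr_fun ?_)
  · simp only [egf]
    simp only [egf] at hzero
    linear_combination hzero
  · intro m
    linear_combination z ^ m / (m ! : ℂ) * h.evenExtend_eq m

theorem osRec_eq_linear_comb (R b : ℝ) (u₀ v₀ : ℂ) (n : ℕ) :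
    osRec R b 0 u₀ v₀ n = u₀ • osRec R b 0 1 0 n + v₀ • osRec R b 0 0 1 n := by
  induction n with
  | zero => simp [osRec]
  | succ n ih =>
    simp only [osRec, ih]
    ext <;> simp <;> ring

theorem norm_osRec_le {R b : ℝ} (hR : |R| ≤ 5816) (hb : |b| ≤ 4298) (u₀ v₀ : ℂ) (n : ℕ) :
    ‖(osRec R b 0 u₀ v₀ n).1‖ ≤ (‖u₀‖ + ‖v₀‖) * majorant n := by
  refine ((isOSRec_osRec R b 0 u₀ v₀).osBound (by positivity) hR hb ?_ ?_ fun n => ?_).u_le n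
  · simp [osRec]
  · simp only [osRec]
    linarith [norm_nonneg u₀, norm_nonneg v₀]
  · simp only [Pi.zero_apply, norm_zero]; positivity

theorem endpointSum_eq_linear_comb {c : ℕ → ℂ} (hc : IsEndpointWeight c) {R b : ℝ}
    (hR : |R| ≤ 5816) (hb : |b| ≤ 4298) (u₀ v₀ : ℂ) :
    endpointSum c u₀ v₀ R b = u₀ * endpointSum c 1 0 R b + v₀ * endpointSum c 0 1 R b := by
  have s1 := hc.summable (norm_osRec_le hR hb 1 0)
  have s2 := hc.summable (norm_osRec_le hR hb 0 1)
  rw [endpointSum, endpointSum, endpointSum, ← tsum_mul_left, ← tsum_mul_left,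
    ← (s1.mul_left u₀).tsum_add (s2.mul_left v₀)]
  refine tsum_congr fun n => ?_
  rw [osRec_eq_linear_comb]
  simp only [Prod.fst_add, Prod.smul_fst, smul_eq_mul]
  ring

end

/-- Theorem 6.3 of the paper (non-invertibility under flow reversal): there exist `A < 0`,
`C < 3|A|`, `T > 0` and a nonzero `C⁴` function `φ` with `φ(±1) = φ'(±1) = 0` solving the
homogeneous Orr–Sommerfeld equation at Fourier mode `T` for the profile `F(y) = 3Ay² + C`;
hence the linearized operator at this Couette–Poiseuille flow in the `2π/T`-periodic channel
is not injective. -/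
theorem stmt_17 :
    ∃ (A C T : ℝ) (φ : ℝ → ℂ), A < 0 ∧ C < 3 * |A| ∧ 0 < T ∧
      ContDiff ℝ 4 φ ∧ ¬(∀ y ∈ Set.Icc (-1 : ℝ) 1, φ y = 0) ∧
      φ (-1) = 0 ∧ φ 1 = 0 ∧ deriv φ (-1) = 0 ∧ deriv φ 1 = 0 ∧
      ∀ y ∈ Set.Ioo (-1 : ℝ) 1,
        iteratedDeriv 4 φ y - 2 * (T : ℂ) ^ 2 * iteratedDeriv 2 φ y + (T : ℂ) ^ 4 * φ y
          - Complex.I * (T : ℂ) *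
              (((3 * A * y ^ 2 + C : ℝ) : ℂ) * (iteratedDeriv 2 φ y - (T : ℂ) ^ 2 * φ y)
                - 6 * (A : ℂ) * φ y) = 0 := by
  obtain ⟨R, b, hR, hb, hdet⟩ := exists_endpointDet_eq_zero
  have hR' : |R| ≤ 5816 := abs_le_of_abs_sub_le hR reynolds_bound
  have hb' : |b| ≤ 4298 := abs_le_of_abs_sub_le hb shift_bound
  have hR5000 := lt_of_abs_sub_reynolds_le hR
  set u₀ := endpointSum valueWeight 0 1 R b with hu₀
  set v₀ := -endpointSum valueWeight 1 0 R b with hv₀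
  set u := fun n => (osRec R b 0 u₀ v₀ n).1
  have hu : ∀ n, ‖u n‖ ≤ (‖u₀‖ + ‖v₀‖) * majorant n := norm_osRec_le hR' hb' u₀ v₀
  have hf := entireEgf_evenExtend hu
  set φ : ℝ → ℂ := fun y => egf (evenExtend u) y with hφ
  have hneg : ∀ y, φ (-y) = φ y := fun y => by
    simp only [hφ, Complex.ofReal_neg, egf_evenExtend_neg]
  have hval : φ 1 = 0 := by
    simp only [hφ, Complex.ofReal_one, egf_evenExtend_one]
    refine (endpointSum_eq_linear_comb isEndpointWeight_value hR' hb' u₀ v₀).trans ?_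
    rw [hu₀, hv₀]; ring
  have hslope : deriv φ 1 = 0 := by
    rw [hφ, hf.deriv_ofReal]
    simp only [Complex.ofReal_one]
    rw [egf_evenExtend_shift_one (isEndpointWeight_slope.summable hu)]
    refine (endpointSum_eq_linear_comb isEndpointWeight_slope hR' hb' u₀ v₀).trans ?_
    rw [endpointDet] at hdet
    rw [hu₀, hv₀]
    linear_combination -hdet
  refine ⟨-R / 3, b, 1, φ, by linarith, ?_, one_pos, hf.contDiff 4, fun h => ?_,
    by rw [hneg, hval], hval, ?_, hslope, fun y _ => ?_⟩
  · rw [abs_of_neg (by linarith)]; linarith [(abs_le.1 hb').2]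
  · refine endpointSum_value_ne_zero hR hb ?_
    have := h 0 (by norm_num)
    simp only [hφ, Complex.ofReal_zero, egf_evenExtend_zero] at this
    exact this
  · have := deriv_comp_neg φ 1
    rw [funext hneg, hslope] at this
    exact neg_eq_zero.1 this.symm
  · rw [hφ, hf.iteratedDeriv_ofReal 4, hf.iteratedDeriv_ofReal 2]
    have := (isOSRec_osRec R b 0 u₀ v₀).egf_eq hu y
    push_cast
    linear_combination this
end
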